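/- arXiv:2502.03105 — 6 statements merged into one kernel-verified Lean document; each statement's English description precedes it below -/
import Mathlib

section
/- Let s ≥ 2, k ≥ 2, and n ≥ s be integers. Then the sequence f_1 = (s−1)·(n^{k−1} − (n−1)^{k−1}) − 1, f_2 = … = f_s = (s−1)·n^{k−1} is not satisfying: there exist cross-dependent families F_1, …, F_s ⊆ [n]^k with |F_1| > (s−1)·(n^{k−1} − (n−1)^{k−1}) − 1 and |F_i| > (s−1)·n^{k−1} for all i ∈ {2, …, s}. -/
/-- The tuples of length `m + 1` with first entry in `A` and remaining entries in `T`. -/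
def consFamily {α : Type*} [DecidableEq α] {m : ℕ} (A : Finset α) (T : Finset (Fin m → α)) :
    Finset (Fin (m + 1) → α) :=
  (A ×ˢ T).image fun p => (Fin.cons p.1 p.2 : Fin (m + 1) → α)

theorem mem_consFamily {α : Type*} [DecidableEq α] {m : ℕ} {A : Finset α}
    {T : Finset (Fin m → α)} {x : Fin (m + 1) → α} :
    x ∈ consFamily A T ↔ x 0 ∈ A ∧ Fin.tail x ∈ T := by
  simp only [consFamily, Finset.mem_image, Finset.mem_product, Prod.exists]
  constructor
  · rintro ⟨a, y, ⟨ha, hy⟩, rfl⟩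
    simpa using ⟨ha, hy⟩
  · rintro ⟨ha, hy⟩
    exact ⟨x 0, Fin.tail x, ⟨ha, hy⟩, Fin.cons_self_tail x⟩

theorem card_consFamily {α : Type*} [DecidableEq α] {m : ℕ} (A : Finset α)
    (T : Finset (Fin m → α)) : (consFamily A T).card = A.card * T.card := by
  rw [consFamily, Finset.card_image_of_injective, Finset.card_product]
  rintro ⟨a, y⟩ ⟨b, z⟩ h
  obtain ⟨h₁, h₂⟩ := Fin.cons_injective2 h
  exact Prod.ext h₁ h₂

theorem card_filter_exists_eq {α : Type*} [Fintype α] [DecidableEq α] (m : ℕ) (a : α) :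
    (Finset.univ.filter fun y : Fin m → α => ∃ j, y j = a).card +
      (Fintype.card α - 1) ^ m = Fintype.card α ^ m := by
  have h : (Finset.univ.filter fun y : Fin m → α => ¬ ∃ j, y j = a) =
      Fintype.piFinset fun _ => Finset.univ.erase a := by
    ext y
    simp
  have hc : (Finset.univ.filter fun y : Fin m → α => ¬ ∃ j, y j = a).card =
      (Fintype.card α - 1) ^ m := by
    rw [h, Fintype.card_piFinset_const, Finset.card_erase_of_mem (Finset.mem_univ a),
      Finset.card_univ]
  rw [← hc, Finset.card_filter_add_card_filter_not]
  simp

/-- Claim 2.1: the sequence `(s-1)(n^{k-1}-(n-1)^{k-1})-1, (s-1)n^{k-1}, …, (s-1)n^{k-1}`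
is not satisfying. -/
theorem stmt3 (s k n : ℕ) (hs : 2 ≤ s) (hk : 2 ≤ k) (hn : s ≤ n) :
    ∃ F : Fin s → Finset (Fin k → Fin n),
      (¬ ∃ g : Fin s → (Fin k → Fin n), (∀ i, g i ∈ F i) ∧
        ∀ i i', i ≠ i' → ∀ j, g i j ≠ g i' j) ∧
      ((s : ℤ) - 1) * ((n : ℤ) ^ (k - 1) - ((n : ℤ) - 1) ^ (k - 1)) - 1 <
        ((F ⟨0, by omega⟩).card : ℤ) ∧
      ∀ i : Fin s, i ≠ ⟨0, by omega⟩ →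
        ((s : ℤ) - 1) * (n : ℤ) ^ (k - 1) < ((F i).card : ℤ) := by
  obtain ⟨m, rfl⟩ : ∃ m, k = m + 1 := ⟨k - 1, by omega⟩
  obtain ⟨N, rfl⟩ : ∃ N, n = N + 1 := ⟨n - 1, by omega⟩
  obtain ⟨A, -, hA⟩ := Finset.exists_subset_card_eq
    (s := (Finset.univ : Finset (Fin (N + 1)))) (n := s - 1) (by simp; omega)
  obtain ⟨b, hb⟩ : ∃ b, b ∉ A := by
    by_contra! h
    have := Finset.card_eq_iff_eq_univ A |>.2 (Finset.eq_univ_iff_forall.2 h)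
    simp at this
    omega
  set T : Finset (Fin m → Fin (N + 1)) := Finset.univ.filter fun y => ∃ j, y j = 0 with hT
  have hs' : ((s - 1 : ℕ) : ℤ) = (s : ℤ) - 1 := by
    push_cast [show 1 ≤ s by omega]
    ring
  refine ⟨fun i => if i = ⟨0, by omega⟩ then consFamily A T else
    insert (Fin.cons b fun _ => 0) (consFamily A Finset.univ), ?_, ?_, ?_⟩
  · rintro ⟨g, hg, hdisj⟩
    have h0 := hg ⟨0, by omega⟩
    beta_reduce at h0
    rw [if_pos rfl, mem_consFamily, hT, Finset.mem_filter] at h0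
    obtain ⟨h0A, -, j, hj⟩ := h0
    have hgA : ∀ i, g i 0 ∈ A := by
      intro i
      by_cases hi : i = ⟨0, by omega⟩
      · rwa [hi]
      · have h := hg i
        beta_reduce at h
        rw [if_neg hi, Finset.mem_insert, mem_consFamily] at h
        rcases h with h | h
        · refine absurd ?_ (hdisj i _ hi j.succ)
          rw [h, Fin.cons_succ]
          exact hj.symm
        · exact h.1
    have hcard := Finset.card_le_card_of_injOn (s := Finset.univ) (fun i => g i 0)
      (fun i _ => hgA i) (fun i _ i' _ h => by_contra fun hne => hdisj i i' hne 0 h)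
    rw [hA, Finset.card_univ, Fintype.card_fin] at hcard
    omega
  · have h := card_filter_exists_eq m (0 : Fin (N + 1))
    rw [← hT, Fintype.card_fin, Nat.add_sub_cancel] at h
    have h' : (T.card : ℤ) = ((N : ℤ) + 1) ^ m - (N : ℤ) ^ m := by
      rw [eq_sub_iff_add_eq]
      exact_mod_cast h
    beta_reduce
    rw [if_pos rfl, card_consFamily, hA]
    push_cast [hs', h']
    simp
  · intro i hi
    beta_reduce
    rw [if_neg hi, Finset.card_insert_of_notMem (by simp [mem_consFamily, hb]),
      card_consFamily, hA]
    push_cast [hs']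
    simp
end

section
/- For every real C > 0 there exists s_0 (depending only on C) such that for all integers s > s_0, all integers n ≥ s, and all integers k with k − 1 ≥ 3·C·n·√(log s / s), the sequence f_i = min(s−1, i + C√(s·log s))·n^{k−1} (i = 1, …, s) is not satisfying: there exist cross-dependent families F_1, …, F_s ⊆ [n]^k with |F_i| > f_i for all i ∈ [s]. (log denotes the natural logarithm.) -/
/-- The box of tuples whose first entry lies in `A` and whose other entries lie in `B`. -/
def headTailBox {n k : ℕ} (A B : Finset (Fin n)) : Finset (Fin (k + 1) → Fin n) :=
  Fintype.piFinset fun j => if j = 0 then A else B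

theorem mem_headTailBox {n k : ℕ} {A B : Finset (Fin n)} {x : Fin (k + 1) → Fin n} :
    x ∈ headTailBox A B ↔ x 0 ∈ A ∧ ∀ j : Fin k, x j.succ ∈ B := by
  simp [headTailBox, Fintype.mem_piFinset, Fin.forall_fin_succ]

theorem card_headTailBox {n k : ℕ} (A B : Finset (Fin n)) :
    (headTailBox A B : Finset (Fin (k + 1) → Fin n)).card = A.card * B.card ^ k := by
  simp [headTailBox, Fintype.card_piFinset, Fin.prod_univ_succ]

/-- A Hilton–Milner type construction: if `A` has fewer than `s` elements, one family consists of
the tuples starting in `A` and containing `z` later on, and the others consist of the tuples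
starting in `A` together with those equal to `z` after the first entry, then the families are
cross-dependent. -/
theorem hiltonMilner_crossDependent {s n k : ℕ} (i₀ : Fin s) (A : Finset (Fin n))
    (hA : A.card < s) (z : Fin n) :
    ¬ ∃ g : Fin s → (Fin (k + 1) → Fin n),
      (∀ i, g i ∈ if i = i₀ then headTailBox A Finset.univ \ headTailBox A {z}ᶜ
        else headTailBox A Finset.univ ∪ headTailBox Finset.univ {z}) ∧
      ∀ i i', i ≠ i' → ∀ j, g i j ≠ g i' j := by
  rintro ⟨g, hg, hdisj⟩
  obtain ⟨i, hi⟩ : ∃ i, g i 0 ∉ A := by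
    by_contra! h
    have hinj : Function.Injective fun i => g i 0 := fun i i' h' => by
      by_contra hne
      exact hdisj i i' hne 0 h'
    have := Finset.card_le_card_of_injOn (s := Finset.univ) (t := A) (fun i => g i 0)
      (fun i _ => h i) hinj.injOn
    rw [Finset.card_univ, Fintype.card_fin] at this
    omega
  have h₀ := hg i₀
  have h₁ := hg i
  rw [if_pos rfl, Finset.mem_sdiff, mem_headTailBox, mem_headTailBox] at h₀
  have hne : i ≠ i₀ := by
    rintro rfl
    exact hi h₀.1.1
  rw [if_neg hne, Finset.mem_union, mem_headTailBox, mem_headTailBox] at h₁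
  obtain ⟨j, hj⟩ : ∃ j : Fin k, g i₀ j.succ = z := by
    by_contra! h
    exact h₀.2 ⟨h₀.1.1, fun j => by simpa using h j⟩
  rcases h₁ with h₁ | h₁
  · exact hi h₁.1
  · exact hdisj i i₀ hne j.succ ((Finset.mem_singleton.1 (h₁.2 j)).trans hj.symm)

theorem card_headTailBox_sdiff {n k : ℕ} (A : Finset (Fin n)) (z : Fin n) :
    (((headTailBox A Finset.univ \ headTailBox A {z}ᶜ :
      Finset (Fin (k + 1) → Fin n)).card : ℕ) : ℝ) =
      A.card * ((n : ℝ) ^ k - ((n : ℝ) - 1) ^ k) := by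
  have hsub : (headTailBox A {z}ᶜ : Finset (Fin (k + 1) → Fin n)) ⊆
      headTailBox A Finset.univ := fun x hx => by
    rw [mem_headTailBox] at hx ⊢
    exact ⟨hx.1, fun j => Finset.mem_univ _⟩
  have hn : 1 ≤ n := z.pos
  rw [Finset.cast_card_sdiff hsub, card_headTailBox, card_headTailBox, Finset.card_compl]
  simp only [Finset.card_univ, Fintype.card_fin, Finset.card_singleton]
  push_cast [Nat.cast_sub hn]
  ring

theorem card_mul_pow_lt_card_headTailBox_union {n k : ℕ} {A : Finset (Fin n)} (z : Fin n)
    {w : Fin n} (hw : w ∉ A) :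
    A.card * n ^ k < (headTailBox A Finset.univ ∪ headTailBox Finset.univ {z} :
      Finset (Fin (k + 1) → Fin n)).card := by
  have hcard : (headTailBox A Finset.univ : Finset (Fin (k + 1) → Fin n)).card =
      A.card * n ^ k := by
    rw [card_headTailBox, Finset.card_univ, Fintype.card_fin]
  rw [← hcard]
  refine Finset.card_lt_card (Finset.ssubset_iff_subset_ne.2 ⟨Finset.subset_union_left, ?_⟩)
  intro h
  have hx : (Fin.cons w fun _ => z : Fin (k + 1) → Fin n) ∈
      headTailBox A Finset.univ ∪ headTailBox Finset.univ {z} := by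
    rw [Finset.mem_union, mem_headTailBox, mem_headTailBox]
    simp
  rw [← h, mem_headTailBox] at hx
  exact hw (by simpa using hx.1)

theorem half_le_one_sub_exp_neg {y : ℝ} (h0 : 0 ≤ y) (h1 : y ≤ 1) :
    y / 2 ≤ 1 - Real.exp (-y) := by
  have h := Real.add_one_le_exp y
  have h' : Real.exp (-y) ≤ (y + 1)⁻¹ := by
    rw [Real.exp_neg]
    exact inv_anti₀ (by linarith) h
  have h'' : (y + 1)⁻¹ ≤ 1 - y / 2 := by
    rw [inv_le_iff_one_le_mul₀ (by linarith)]
    nlinarith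
  linarith

theorem sub_one_pow_le {n k : ℕ} (hn : 1 ≤ n) {y : ℝ} (hy : y * n ≤ k) :
    ((n : ℝ) - 1) ^ k ≤ Real.exp (-y) * (n : ℝ) ^ k := by
  have hn' : (1 : ℝ) ≤ n := by exact_mod_cast hn
  have hn0 : (0 : ℝ) < n := by linarith
  have h1 : (n : ℝ) - 1 ≤ Real.exp (-(1 / n)) * n := by
    have := mul_le_mul_of_nonneg_right (Real.add_one_le_exp (-(1 / (n : ℝ)))) hn0.le
    have h : (-(1 / (n : ℝ)) + 1) * n = n - 1 := by field_simp; ring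
    linarith
  calc ((n : ℝ) - 1) ^ k ≤ (Real.exp (-(1 / n)) * n) ^ k :=
        pow_le_pow_left₀ (by linarith) h1 k
    _ = Real.exp (-(k / n)) * (n : ℝ) ^ k := by
        rw [mul_pow, ← Real.exp_nat_mul]
        congr 2
        ring
    _ ≤ Real.exp (-y) * (n : ℝ) ^ k := by
        gcongr
        rwa [le_div_iff₀ hn0]

/-- Claim 2.2: the sequence `f_i = min(s-1, i + C√(s log s))·n^{k-1}` is not satisfying
for `s > s₀(C)` and `k - 1 ≥ 3Cn√(log s / s)`. -/
theorem stmt4 (C : ℝ) (hC : 0 < C) :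
    ∃ s0 : ℕ, ∀ s : ℕ, s0 < s → ∀ n : ℕ, s ≤ n → ∀ k : ℕ,
      3 * C * n * Real.sqrt (Real.log s / s) ≤ (k : ℝ) - 1 →
      ∃ F : Fin s → Finset (Fin k → Fin n),
        (¬ ∃ g : Fin s → (Fin k → Fin n), (∀ i, g i ∈ F i) ∧
          ∀ i i', i ≠ i' → ∀ j, g i j ≠ g i' j) ∧
        ∀ i : Fin s,
          min ((s : ℝ) - 1) (((i : ℕ) + 1 : ℝ) + C * Real.sqrt ((s : ℝ) * Real.log s)) *
            (n : ℝ) ^ ((k : ℤ) - 1) < ((F i).card : ℝ) := by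
  have hev : ∀ᶠ s : ℕ in Filter.atTop, 6 ≤ s ∧ Real.log s ≤ (9 * C ^ 2)⁻¹ * s ∧
      16 / C ^ 2 < s := by
    refine (Filter.eventually_ge_atTop 6).and (Filter.Eventually.and ?_ ?_)
    · have h := Real.isLittleO_log_id_atTop.bound (show 0 < (9 * C ^ 2)⁻¹ by positivity)
      filter_upwards [tendsto_natCast_atTop_atTop.eventually h] with s hs
      simp only [id, Real.norm_eq_abs, Nat.abs_cast] at hs
      exact (le_abs_self _).trans hs
    · exact tendsto_natCast_atTop_atTop.eventually (Filter.eventually_gt_atTop _)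
  obtain ⟨s0, hs0⟩ := Filter.eventually_atTop.1 hev
  refine ⟨s0, fun s hs n hn k hk => ?_⟩
  obtain ⟨h6, hlog, hbig⟩ := hs0 s hs.le
  have h6' : (6 : ℝ) ≤ s := by exact_mod_cast h6
  have hs_pos : (0 : ℝ) < s := by linarith
  have hlog1 : 1 ≤ Real.log s := by
    rw [Real.le_log_iff_exp_le hs_pos]
    linarith [Real.exp_one_lt_d9]
  set y := 3 * C * Real.sqrt (Real.log s / s) with hy
  set m := C * Real.sqrt (s * Real.log s) with hm
  have hy0 : 0 ≤ y := by positivity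
  have hym : y * s = 3 * m := by
    have : Real.sqrt (s * Real.log s) = Real.sqrt (Real.log s / s) * s := by
      rw [show (s : ℝ) * Real.log s = Real.log s / s * s ^ 2 by field_simp,
        Real.sqrt_mul' _ (by positivity), Real.sqrt_sq hs_pos.le]
    rw [hy, hm, this]
    ring
  have hy1 : y ≤ 1 := by
    have hsq : y ^ 2 ≤ 1 := by
      rw [hy, mul_pow, Real.sq_sqrt (by positivity), mul_div_assoc', div_le_one hs_pos]
      calc (3 * C) ^ 2 * Real.log s ≤ (3 * C) ^ 2 * ((9 * C ^ 2)⁻¹ * s) := by gcongr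
        _ = (s : ℝ) := by field_simp; ring
    exact (sq_le_one_iff₀ hy0).1 hsq
  have hm4 : 4 < m := by
    have hsq : 4 ^ 2 < m ^ 2 := by
      rw [hm, mul_pow, Real.sq_sqrt (by positivity)]
      rw [div_lt_iff₀ (by positivity)] at hbig
      have : C ^ 2 * s * 1 ≤ C ^ 2 * s * Real.log s := by gcongr
      linarith
    exact lt_of_pow_lt_pow_left₀ 2 (by positivity) hsq
  have hyn : y * n ≤ (k : ℝ) - 1 := by
    rw [hy]
    linarith
  obtain ⟨k, rfl⟩ : ∃ k', k = k' + 1 := by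
    refine Nat.exists_eq_succ_of_ne_zero ?_
    rintro rfl
    have : 0 ≤ y * n := by positivity
    norm_num at hyn
    linarith
  have hpow : (n : ℝ) ^ (((k + 1 : ℕ) : ℤ) - 1) = (n : ℝ) ^ k := by simp
  rw [hpow]
  have hyk : y * n ≤ k := by
    push_cast at hyn
    linarith
  have hn0 : 0 < n := by omega
  have hnk : (0 : ℝ) < (n : ℝ) ^ k := by positivity
  let w : Fin n := ⟨s - 1, by omega⟩
  let A : Finset (Fin n) := Finset.Iio w
  have hAcard : A.card = s - 1 := Fin.card_Iio w
  have hAcast : (A.card : ℝ) = s - 1 := by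
    rw [hAcard, Nat.cast_sub (by omega)]
    simp
  let z : Fin n := ⟨0, hn0⟩
  let i₀ : Fin s := ⟨0, by omega⟩
  refine ⟨_, hiltonMilner_crossDependent i₀ A (by omega) z, fun i => ?_⟩
  by_cases hi : i = i₀
  · rw [if_pos hi, card_headTailBox_sdiff, hAcast]
    have hi0 : ((i : ℕ) : ℝ) = 0 := by simp [hi, i₀]
    rw [hi0]
    have hhalf := half_le_one_sub_exp_neg hy0 hy1
    have hmain : 0 + 1 + m < (s - 1) * (y / 2) := by
      have : y * 4 ≤ 2 * m := by nlinarith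
      linarith
    calc min ((s : ℝ) - 1) (0 + 1 + m) * (n : ℝ) ^ k
        ≤ (0 + 1 + m) * (n : ℝ) ^ k := by gcongr; exact min_le_right _ _
      _ < (s - 1) * (y / 2) * (n : ℝ) ^ k := by gcongr
      _ ≤ (s - 1) * (1 - Real.exp (-y)) * (n : ℝ) ^ k := by
          gcongr
          linarith
      _ = (s - 1) * ((n : ℝ) ^ k - Real.exp (-y) * (n : ℝ) ^ k) := by ring
      _ ≤ (s - 1) * ((n : ℝ) ^ k - ((n : ℝ) - 1) ^ k) := by
          have := sub_one_pow_le (k := k) hn0 hyk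
          exact mul_le_mul_of_nonneg_left (by linarith) (by linarith)
  · rw [if_neg hi]
    have hlt := card_mul_pow_lt_card_headTailBox_union (k := k) z
      (show w ∉ A by simp [A])
    calc min ((s : ℝ) - 1) ((i : ℕ) + 1 + m) * (n : ℝ) ^ k
        ≤ (s - 1) * (n : ℝ) ^ k := by gcongr; exact min_le_left _ _
      _ = ((A.card * n ^ k : ℕ) : ℝ) := by push_cast [hAcast]; rfl
      _ < _ := by exact_mod_cast hlt
end

section
/- Let s ≥ 2, k ≥ 2 be integers and n ≥ ⌈s/2⌉ an integer. Then the sequence g_1 = ⌈s/2⌉·⌊s/2⌋·n^{k−2} − 1, g_2 = … = g_s = s·n^{k−1} − ⌈s/2⌉·⌊s/2⌋·n^{k−2} − 1 is not satisfying: there exist cross-dependent families F_1, …, F_s ⊆ [n]^k with |F_i| > g_i for all i ∈ [s]. -/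
/-- A box constrained only in its first two coordinates. -/
theorem card_filter_first_two {n m : ℕ} (S T : Finset (Fin n)) :
    (Finset.univ.filter fun x : Fin (m + 2) → Fin n => x 0 ∈ S ∧ x 1 ∈ T).card =
      S.card * T.card * n ^ m := by
  have h : (Finset.univ.filter fun x : Fin (m + 2) → Fin n => x 0 ∈ S ∧ x 1 ∈ T) =
      Fintype.piFinset (Fin.cons S (Fin.cons T fun _ => Finset.univ)) := by
    ext x
    simp [Fintype.mem_piFinset, Fin.forall_fin_succ]
  rw [h, Fintype.card_piFinset, Fin.prod_univ_succ, Fin.prod_univ_succ]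
  simp [mul_assoc]

/-- Inclusion-exclusion for tuples constrained in one of the first two coordinates. -/
theorem card_filter_first_or_second {n m : ℕ} (S T : Finset (Fin n)) :
    (Finset.univ.filter fun x : Fin (m + 2) → Fin n => x 0 ∈ S ∨ x 1 ∈ T).card +
      S.card * T.card * n ^ m = (S.card + T.card) * n ^ (m + 1) := by
  have h₁ := card_filter_first_two (m := m) S Finset.univ
  have h₂ := card_filter_first_two (m := m) Finset.univ T
  simp only [Finset.mem_univ, and_true, true_and, Finset.card_univ, Fintype.card_fin] at h₁ h₂
  rw [← card_filter_first_two S T, Finset.filter_or, Finset.filter_and,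
    Finset.card_union_add_card_inter, h₁, h₂]
  ring

/-- Families of tuples meeting `S` in coordinate `p` or `T` in coordinate `q`, one of them in both,
admit no rainbow matching when there are at least `#S + #T` of them. -/
theorem not_pairwise_disjoint_of_card_le {s n k : ℕ} (S T : Finset (Fin n)) (p q : Fin k)
    (hST : S.card + T.card ≤ s) (g : Fin s → Fin k → Fin n) (i₀ : Fin s)
    (h₀ : g i₀ p ∈ S ∧ g i₀ q ∈ T) (h : ∀ i, g i p ∈ S ∨ g i q ∈ T) :
    ¬ ∀ i i', i ≠ i' → ∀ j, g i j ≠ g i' j := by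
  intro hd
  have hinj : ∀ j, Function.Injective fun i => g i j := fun j i i' hii => by
    by_contra hne
    exact hd i i' hne j hii
  have hle : ∀ (j : Fin k) (U : Finset (Fin n)),
      (Finset.univ.filter fun i => g i j ∈ U).card ≤ U.card := fun j U =>
    Finset.card_le_card_of_injOn (fun i => g i j) (fun i hi => by simpa using hi)
      (hinj j).injOn
  have hu := Finset.card_union_add_card_inter
    (Finset.univ.filter fun i => g i p ∈ S) (Finset.univ.filter fun i => g i q ∈ T)
  rw [← Finset.filter_or, ← Finset.filter_and, Finset.filter_true_of_mem fun i _ => h i,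
    Finset.card_univ, Fintype.card_fin] at hu
  have hpos : 0 < (Finset.univ.filter fun i => g i p ∈ S ∧ g i q ∈ T).card :=
    Finset.card_pos.mpr ⟨i₀, by simpa using h₀⟩
  have := hle p S
  have := hle q T
  omega


/-- Claim 2.3: the sequence `g₁ = ⌈s/2⌉⌊s/2⌋n^{k-2} - 1`,
`g₂ = … = g_s = sn^{k-1} - ⌈s/2⌉⌊s/2⌋n^{k-2} - 1` is not satisfying. -/
theorem stmt5 (s k n : ℕ) (hs : 2 ≤ s) (hk : 2 ≤ k) (hn : (s + 1) / 2 ≤ n) :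
    ∃ F : Fin s → Finset (Fin k → Fin n),
      (¬ ∃ g : Fin s → (Fin k → Fin n), (∀ i, g i ∈ F i) ∧
        ∀ i i', i ≠ i' → ∀ j, g i j ≠ g i' j) ∧
      ((((s + 1) / 2 : ℕ) : ℤ) * (((s / 2 : ℕ)) : ℤ) * (n : ℤ) ^ (k - 2) - 1 <
        ((F ⟨0, by omega⟩).card : ℤ)) ∧
      ∀ i : Fin s, i ≠ ⟨0, by omega⟩ →
        (s : ℤ) * (n : ℤ) ^ (k - 1) -
          (((s + 1) / 2 : ℕ) : ℤ) * (((s / 2 : ℕ)) : ℤ) * (n : ℤ) ^ (k - 2) - 1 <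
          ((F i).card : ℤ) := by
  obtain ⟨m, rfl⟩ : ∃ m, k = m + 2 := ⟨k - 2, by omega⟩
  obtain ⟨S, -, hS⟩ := Finset.exists_subset_card_eq (s := (Finset.univ : Finset (Fin n)))
    (n := (s + 1) / 2) (by simpa using hn)
  obtain ⟨T, -, hT⟩ := Finset.exists_subset_card_eq (s := (Finset.univ : Finset (Fin n)))
    (n := s / 2) (by simp only [Finset.card_univ, Fintype.card_fin]; omega)
  have hsum : S.card + T.card = s := by omega
  have hand := card_filter_first_two (m := m) S T
  have hor := card_filter_first_or_second (m := m) S T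
  rw [hsum] at hor
  refine ⟨fun i => if i = ⟨0, by omega⟩
    then Finset.univ.filter fun x => x 0 ∈ S ∧ x 1 ∈ T
    else Finset.univ.filter fun x => x 0 ∈ S ∨ x 1 ∈ T, ?_, ?_, ?_⟩
  · rintro ⟨g, hg, hd⟩
    have h₀ : g ⟨0, by omega⟩ 0 ∈ S ∧ g ⟨0, by omega⟩ 1 ∈ T := by
      simpa using hg ⟨0, by omega⟩
    refine not_pairwise_disjoint_of_card_le S T 0 1 hsum.le g ⟨0, by omega⟩ h₀ (fun i => ?_) hd
    by_cases hi : i = ⟨0, by omega⟩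
    · subst hi
      exact Or.inl h₀.1
    · simpa [hi] using hg i
  · beta_reduce
    rw [if_pos rfl, hand, ← hS, ← hT, Nat.add_sub_cancel]
    push_cast
    linarith
  · intro i hi
    beta_reduce
    rw [if_neg hi, ← hS, ← hT, Nat.add_sub_cancel, show m + 2 - 1 = m + 1 by omega]
    zify at hor
    linarith
end

section
/- Let s ≥ 2, k ≥ 2 be integers and n an integer with n ≥ s²/2. Then the sequence g_i = (i−1)·n^{k−1} + ⌈s/2⌉·⌊s/2⌋·n^{k−2} − 1 (i = 1, …, s) is not satisfying: there exist cross-dependent families F_1, …, F_s ⊆ [n]^k with |F_i| > g_i for all i ∈ [s]. -/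
open Finset in
/-- Distinct values at a coordinate bound the number of indices whose value lies in `A`. -/
theorem card_filter_mem_le_of_injective {ι α : Type*} [Fintype ι] [DecidableEq α]
    (f : ι → α) (hf : Function.Injective f) (A : Finset α) :
    #{i | f i ∈ A} ≤ #A :=
  card_le_card_of_injOn f (fun i hi => by simpa using hi) hf.injOn

open Finset in
theorem card_filter_zero_mem {n m : ℕ} (A : Finset (Fin n)) :
    #{x : Fin (m + 2) → Fin n | x 0 ∈ A} = #A * n ^ (m + 1) := by
  have h : ({x : Fin (m + 2) → Fin n | x 0 ∈ A} : Finset _) =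
      Fintype.piFinset (Fin.cons A fun _ => univ : Fin (m + 2) → Finset (Fin n)) := by
    ext x
    simp [Fin.forall_fin_succ]
  rw [h, Fintype.card_piFinset, Fin.prod_univ_succ]
  simp

open Finset in
theorem card_filter_one_mem {n m : ℕ} (B : Finset (Fin n)) :
    #{x : Fin (m + 2) → Fin n | x 1 ∈ B} = #B * n ^ (m + 1) := by
  have h : ({x : Fin (m + 2) → Fin n | x 1 ∈ B} : Finset _) =
      Fintype.piFinset
        (Fin.cons univ (Fin.cons B fun _ => univ) : Fin (m + 2) → Finset (Fin n)) := by
    ext x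
    simp [Fin.forall_fin_succ]
  rw [h, Fintype.card_piFinset, Fin.prod_univ_succ, Fin.prod_univ_succ]
  simp
  ring

open Finset in
theorem card_filter_zero_mem_inter_one_mem {n m : ℕ} (A B : Finset (Fin n)) :
    #(({x : Fin (m + 2) → Fin n | x 0 ∈ A} : Finset _) ∩
      ({x : Fin (m + 2) → Fin n | x 1 ∈ B} : Finset _)) = #A * #B * n ^ m := by
  have h : ({x : Fin (m + 2) → Fin n | x 0 ∈ A} : Finset _) ∩
      ({x : Fin (m + 2) → Fin n | x 1 ∈ B} : Finset _) =
      Fintype.piFinset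
        (Fin.cons A (Fin.cons B fun _ => univ) : Fin (m + 2) → Finset (Fin n)) := by
    ext x
    simp [Fin.forall_fin_succ]
  rw [h, Fintype.card_piFinset, Fin.prod_univ_succ, Fin.prod_univ_succ]
  simp
  ring

/-- Claim 2.4: the sequence `g_i = (i-1)n^{k-1} + ⌈s/2⌉⌊s/2⌋n^{k-2} - 1`
is not satisfying for `n ≥ s²/2`. -/
theorem stmt6 (s k n : ℕ) (hs : 2 ≤ s) (hk : 2 ≤ k) (hn : (s : ℝ) ^ 2 / 2 ≤ (n : ℝ)) :
    ∃ F : Fin s → Finset (Fin k → Fin n),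
      (¬ ∃ g : Fin s → (Fin k → Fin n), (∀ i, g i ∈ F i) ∧
        ∀ i i', i ≠ i' → ∀ j, g i j ≠ g i' j) ∧
      ∀ i : Fin s,
        ((i : ℕ) : ℤ) * (n : ℤ) ^ (k - 1) +
          (((s + 1) / 2 : ℕ) : ℤ) * (((s / 2 : ℕ)) : ℤ) * (n : ℤ) ^ (k - 2) - 1 <
          ((F i).card : ℤ) := by
  classical
  obtain ⟨m, rfl⟩ := Nat.exists_eq_add_of_le' hk
  have hn' : s ^ 2 ≤ 2 * n := by
    have : (s : ℝ) ^ 2 ≤ 2 * n := by linarith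
    exact_mod_cast this
  have hsn : s ≤ n := by nlinarith
  have hab : (s + 1) / 2 + s / 2 = s := by omega
  generalize (s + 1) / 2 = a at *
  generalize s / 2 = b at *
  obtain ⟨A, -, hA⟩ := Finset.exists_subset_card_eq
    (s := (Finset.univ : Finset (Fin n))) (n := a) (by simp; omega)
  obtain ⟨B, -, hB⟩ := Finset.exists_subset_card_eq
    (s := (Finset.univ : Finset (Fin n))) (n := b) (by simp; omega)
  set P : Finset (Fin (m + 2) → Fin n) := {x | x 0 ∈ A} with hP
  set Q : Finset (Fin (m + 2) → Fin n) := {x | x 1 ∈ B} with hQ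
  have hPc : P.card = a * n ^ (m + 1) := by rw [hP, card_filter_zero_mem, hA]
  have hQc : Q.card = b * n ^ (m + 1) := by rw [hQ, card_filter_one_mem, hB]
  have hPQ : (P ∩ Q).card = a * b * n ^ m := by
    rw [hP, hQ, card_filter_zero_mem_inter_one_mem, hA, hB]
  refine ⟨fun i => if (i : ℕ) = 0 then P ∩ Q else P ∪ Q, ?_, fun i => ?_⟩
  · rintro ⟨g, hg, hd⟩
    have hinj (j) : Function.Injective fun i => g i j := fun i i' h => by
      by_contra hne
      exact hd i i' hne j h
    have h0 := card_filter_mem_le_of_injective _ (hinj 0) A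
    have h1 := card_filter_mem_le_of_injective _ (hinj 1) B
    have hsum := Finset.card_union_add_card_inter
      ({i | g i 0 ∈ A} : Finset (Fin s)) ({i | g i 1 ∈ B} : Finset (Fin s))
    have hunion : ({i | g i 0 ∈ A} : Finset (Fin s)) ∪ ({i | g i 1 ∈ B} : Finset (Fin s)) =
        Finset.univ := by
      ext i
      have := hg i
      dsimp only at this
      split_ifs at this <;> simp [hP, hQ] at this ⊢ <;> tauto
    have hinter : 0 < (({i | g i 0 ∈ A} : Finset (Fin s)) ∩
        ({i | g i 1 ∈ B} : Finset (Fin s))).card := by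
      refine Finset.card_pos.mpr ⟨⟨0, by omega⟩, ?_⟩
      simpa [hP, hQ] using hg ⟨0, by omega⟩
    rw [hunion, Finset.card_univ, Fintype.card_fin] at hsum
    omega
  · have hi := i.isLt
    simp only [show m + 2 - 1 = m + 1 by omega, Nat.add_sub_cancel]
    split_ifs with h
    · rw [hPQ, h]
      push_cast
      linarith
    · have hu := Finset.card_union_add_card_inter P Q
      rw [hPc, hQc, hPQ, ← add_mul, hab] at hu
      have h2ab : 2 * (a * b) ≤ n := by
        subst hab
        zify at hn' ⊢
        nlinarith [sq_nonneg ((a : ℤ) - b)]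
      have key : (i : ℕ) * n ^ (m + 1) + 2 * (a * b) * n ^ m ≤ s * n ^ (m + 1) := by
        calc (i : ℕ) * n ^ (m + 1) + 2 * (a * b) * n ^ m
            ≤ (i : ℕ) * n ^ (m + 1) + n * n ^ m := by gcongr
          _ = ((i : ℕ) + 1) * n ^ (m + 1) := by ring
          _ ≤ s * n ^ (m + 1) := by gcongr; omega
      zify at hu key
      linarith
end

section
/- For all integers s ≥ 2, k ≥ 1 and n > 2^5 · s · log₂(sk), the sequence f_i = (i−1)·n^{k−1} + 4(s−1)²·n^{k−2} + 2^{15}·s³·(log₂(sk))³·n^{k−3} (i = 1, …, s) is satisfying: whenever families F_1, …, F_s ⊆ [n]^k satisfy |F_i| > f_i for every i ∈ [s], the families contain a rainbow matching. -/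
/-- The colouring `c` with every vertex of `T` recoloured by `d`. -/
def recolor {V C : Type*} [DecidableEq V] (c : V → C) (T : Finset V) (d : C) : V → C :=
  fun v => if v ∈ T then d else c v

/-- The vertices whose colour lies in `D`. -/
def colorClass {V C : Type*} [Fintype V] [DecidableEq C] (c : V → C) (D : Finset C) : Finset V :=
  Finset.univ.filter fun v => c v ∈ D

lemma mem_colorClass {V C : Type*} [Fintype V] [DecidableEq C] {c : V → C} {D : Finset C} {v : V} :
    v ∈ colorClass c D ↔ c v ∈ D := by
  simp only [colorClass, Finset.mem_filter, Finset.mem_univ, true_and]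

lemma card_recolor_fiber_le {V C : Type*} [Fintype V] [DecidableEq V] [Fintype C] [DecidableEq C]
    (c' : V → C) (T : Finset V) (d : C) :
    (Finset.univ.filter fun c : V → C => recolor c T d = c').card ≤ Fintype.card C ^ T.card := by
  have h : Fintype.card (T → C) = Fintype.card C ^ T.card := by simp
  rw [← h, ← Finset.card_univ]
  refine Finset.card_le_card_of_injOn (fun c v => c v.1) (fun _ _ => Finset.mem_univ _) ?_
  intro c₁ h₁ c₂ h₂ h
  simp only [Finset.coe_filter, Finset.mem_univ, true_and, Set.mem_ofPred_eq] at h₁ h₂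
  funext v
  by_cases hv : v ∈ T
  · exact congrFun h ⟨v, hv⟩
  · have := congrFun (h₁.trans h₂.symm) v
    simpa [recolor, hv] using this

lemma exists_min_fragment {V Ω : Type*} [DecidableEq V] [Fintype Ω]
    (A : Ω → Finset V) (W : Finset V) (ω : Ω) :
    ∃ T : Finset V, T ⊆ A ω ∧ Disjoint T W ∧
      (∃ ω', A ω' ⊆ T ∪ W ∧ (A ω').card ≤ (A ω).card) ∧
      ∀ ω', A ω' ⊆ A ω ∪ W → (A ω').card ≤ (A ω).card → T.card ≤ (A ω' \ W).card := by
  classical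
  obtain ⟨ω₀, h₀, hmin⟩ := Finset.exists_min_image
    (Finset.univ.filter fun ω' => A ω' ⊆ A ω ∪ W ∧ (A ω').card ≤ (A ω).card)
    (fun ω' => (A ω' \ W).card) ⟨ω, by simp⟩
  simp only [Finset.mem_filter, Finset.mem_univ, true_and] at h₀ hmin
  refine ⟨A ω₀ \ W, ?_, Finset.sdiff_disjoint, ⟨ω₀, by simp, h₀.2⟩, fun ω' h₁ h₂ => hmin ω' ⟨h₁, h₂⟩⟩
  intro v hv
  have hv' := Finset.mem_sdiff.1 hv
  exact (Finset.mem_union.1 (h₀.1 hv'.1)).resolve_right hv'.2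

lemma exists_smallest_subset {V Ω : Type*} [Fintype Ω] (A : Ω → Finset V) (W : Finset V) :
    ∃ B : Finset V, (∃ ω, A ω ⊆ W) →
      (∃ ω, A ω = B) ∧ B ⊆ W ∧ ∀ ω, A ω ⊆ W → B.card ≤ (A ω).card := by
  classical
  by_cases h : ∃ ω, A ω ⊆ W
  · obtain ⟨ω₁, h₁⟩ := h
    obtain ⟨ω₀, h₀, hmin⟩ := Finset.exists_min_image
      (Finset.univ.filter fun ω' => A ω' ⊆ W) (fun ω' => (A ω').card) ⟨ω₁, by simpa using h₁⟩
    simp only [Finset.mem_filter, Finset.mem_univ, true_and] at h₀ hmin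
    exact ⟨A ω₀, fun _ => ⟨⟨ω₀, rfl⟩, h₀, hmin⟩⟩
  · exact ⟨∅, fun h' => (h h').elim⟩

lemma one_add_le_eight_pow_div (t b : ℕ) :
    (1 : ℝ) + 3 * t - b ≤ 8 ^ t / 2 ^ b := by
  rcases le_total b (3 * t) with h | h
  · obtain ⟨z, hz⟩ := Nat.exists_eq_add_of_le h
    have h8 : (8 : ℝ) ^ t = 2 ^ b * 2 ^ z := by
      rw [← pow_add, ← hz, pow_mul]; norm_num
    have h1 : (z : ℝ) + 1 ≤ 2 ^ z := by exact_mod_cast Nat.lt_two_pow_self (n := z)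
    have h2 : (3 : ℝ) * t = b + z := by exact_mod_cast hz
    rw [h8, mul_div_cancel_left₀ _ (by positivity)]
    linarith
  · rcases h.eq_or_lt with h | h
    · have h8 : (8 : ℝ) ^ t = 2 ^ b := by rw [← h, pow_mul]; norm_num
      have h2 : (3 : ℝ) * t = b := by exact_mod_cast h
      rw [h8, div_self (by positivity)]
      linarith
    · have h2 : (3 : ℝ) * t + 1 ≤ b := by exact_mod_cast h
      have : (0 : ℝ) ≤ 8 ^ t / 2 ^ b := by positivity
      linarith

/-- If every fragment `T ω c` of a spread family can be recovered as a subset of a set depending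
only on the recoloured colouring, then fragments are on average three times smaller than
those sets. -/
lemma sum_card_fragment_le {V C Ω : Type*} [Fintype V] [DecidableEq V] [Fintype C] [DecidableEq C]
    [Fintype Ω] (A : Ω → (V → C) → Finset V) (d : C)
    (hspread : ∀ c S, (Finset.univ.filter fun ω => S ⊆ A ω c).card *
      (8 * Fintype.card C) ^ S.card ≤ Fintype.card Ω)
    (T : Ω → (V → C) → Finset V) (B : (V → C) → Finset V)
    (hTA : ∀ ω c, T ω c ⊆ A ω (recolor c (T ω c) d))
    (hTB : ∀ ω c, T ω c ⊆ B (recolor c (T ω c) d)) :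
    3 * ∑ ω, ∑ c, (T ω c).card ≤ ∑ ω, ∑ c, (B (recolor c (T ω c) d)).card := by
  classical
  have key : ∑ ω, ∑ c, (8 : ℝ) ^ (T ω c).card / 2 ^ (B (recolor c (T ω c) d)).card ≤
      ∑ _ω : Ω, ∑ _c : V → C, (1 : ℝ) := by
    have hN : 0 < Fintype.card C := Fintype.card_pos_iff.2 ⟨d⟩
    calc
      _ ≤ ∑ ω, ∑ c, ∑ c', ∑ S ∈ (B c').powerset,
          if S ⊆ A ω c' ∧ recolor c S d = c' then (8 : ℝ) ^ S.card / 2 ^ (B c').card else 0 := by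
        refine Finset.sum_le_sum fun ω _ => Finset.sum_le_sum fun c _ => ?_
        have hnn : ∀ c' : V → C, ∀ S : Finset V, (0 : ℝ) ≤ if S ⊆ A ω c' ∧ recolor c S d = c'
            then (8 : ℝ) ^ S.card / 2 ^ (B c').card else 0 := by
          intro c' S; split_ifs <;> positivity
        refine le_trans ?_ (Finset.single_le_sum
          (f := fun c' : V → C => ∑ S ∈ (B c').powerset, if S ⊆ A ω c' ∧ recolor c S d = c'
            then (8 : ℝ) ^ S.card / 2 ^ (B c').card else 0)
          (fun c' _ => Finset.sum_nonneg fun S _ => hnn c' S)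
          (Finset.mem_univ (recolor c (T ω c) d)))
        refine le_trans ?_ (Finset.single_le_sum (fun S _ => hnn _ S)
          (Finset.mem_powerset.2 (hTB ω c)))
        rw [if_pos ⟨hTA ω c, rfl⟩]
      _ = ∑ c', ∑ S ∈ (B c').powerset, ∑ ω, ∑ c : V → C,
          if S ⊆ A ω c' ∧ recolor c S d = c' then (8 : ℝ) ^ S.card / 2 ^ (B c').card else 0 := by
        have h1 : ∀ ω, (∑ c : V → C, ∑ c' : V → C, ∑ S ∈ (B c').powerset,
            if S ⊆ A ω c' ∧ recolor c S d = c' then (8 : ℝ) ^ S.card / 2 ^ (B c').card else 0) =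
            ∑ c' : V → C, ∑ S ∈ (B c').powerset, ∑ c : V → C,
            if S ⊆ A ω c' ∧ recolor c S d = c' then (8 : ℝ) ^ S.card / 2 ^ (B c').card else 0 := by
          intro ω
          rw [Finset.sum_comm]
          exact Finset.sum_congr rfl fun c' _ => Finset.sum_comm
        simp_rw [h1]
        rw [Finset.sum_comm]
        exact Finset.sum_congr rfl fun c' _ => Finset.sum_comm
      _ ≤ ∑ c', ∑ S ∈ (B c').powerset, (Fintype.card Ω : ℝ) / 2 ^ (B c').card := by
        refine Finset.sum_le_sum fun c' _ => Finset.sum_le_sum fun S _ => ?_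
        have h1 : (∑ ω, ∑ c : V → C,
            if S ⊆ A ω c' ∧ recolor c S d = c' then (8 : ℝ) ^ S.card / 2 ^ (B c').card else 0) =
            ((Finset.univ.filter fun ω => S ⊆ A ω c').card *
              (Finset.univ.filter fun c : V → C => recolor c S d = c').card : ℕ) *
              ((8 : ℝ) ^ S.card / 2 ^ (B c').card) := by
          rw [← Finset.card_product, ← Finset.sum_product', ← Finset.sum_filter,
            Finset.sum_const, nsmul_eq_mul]
          congr 3
          ext ⟨ω, c⟩
          simp
        rw [h1, ← mul_div_assoc]
        gcongr
        have h2 := hspread c' S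
        have h3 := card_recolor_fiber_le c' S d
        have : ((Finset.univ.filter fun ω => S ⊆ A ω c').card *
              (Finset.univ.filter fun c : V → C => recolor c S d = c').card) * 8 ^ S.card ≤
              Fintype.card Ω := by
          refine le_trans ?_ h2
          rw [mul_assoc, mul_pow, mul_comm (8 ^ _)]
          gcongr
        exact_mod_cast this
      _ = _ := by
        rw [Finset.sum_comm (s := (Finset.univ : Finset Ω))]
        refine Finset.sum_congr rfl fun c' _ => ?_
        rw [Finset.sum_const, Finset.card_powerset, nsmul_eq_mul]
        push_cast
        rw [mul_div_cancel₀ _ (by positivity)]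
        simp
  have h2 : ∑ ω, ∑ c, ((1 : ℝ) + 3 * (T ω c).card - (B (recolor c (T ω c) d)).card) ≤
      ∑ _ω : Ω, ∑ _c : V → C, (1 : ℝ) :=
    le_trans (Finset.sum_le_sum fun ω _ => Finset.sum_le_sum fun c _ =>
      one_add_le_eight_pow_div _ _) key
  simp only [Finset.sum_sub_distrib, Finset.sum_add_distrib, ← Finset.mul_sum] at h2
  have h3 : (3 : ℝ) * ∑ ω, ∑ c, ((T ω c).card : ℝ) ≤
      ∑ ω, ∑ c, ((B (recolor c (T ω c) d)).card : ℝ) := by linarith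
  exact_mod_cast h3

lemma colorClass_recolor {V C : Type*} [Fintype V] [DecidableEq V] [DecidableEq C]
    (c : V → C) (T : Finset V) (d : C) (D : Finset C) (hd : d ∉ D) (hT : ∀ v ∈ T, c v ∉ D) :
    colorClass (recolor c T d) D = colorClass c D := by
  ext v
  by_cases hv : v ∈ T
  · simp [mem_colorClass, recolor, hv, hd, hT v hv]
  · simp [mem_colorClass, recolor, hv]

lemma colorClass_recolor_self {V C : Type*} [Fintype V] [DecidableEq V] [DecidableEq C]
    (c : V → C) (T : Finset V) (d : C) :
    colorClass (recolor c T d) {d} = T ∪ colorClass c {d} := by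
  ext v
  by_cases hv : v ∈ T <;> simp [mem_colorClass, recolor, hv]

/-- Iterated fragments of a spread family, one step for each colour of `D`. -/
lemma exists_iterated_fragments {V C Ω : Type*} [Fintype V] [DecidableEq V] [Fintype C]
    [DecidableEq C] [Fintype Ω] (A₀ : Ω → Finset V)
    (hspread : ∀ S, (Finset.univ.filter fun ω => S ⊆ A₀ ω).card *
      (8 * Fintype.card C) ^ S.card ≤ Fintype.card Ω) (D : Finset C) :
    ∃ A : Ω → (V → C) → Finset V,
      (∀ ω c, A ω c ⊆ A₀ ω) ∧
      (∀ c T d, d ∉ D → (∀ v ∈ T, c v ∉ D) → ∀ ω, A ω (recolor c T d) = A ω c) ∧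
      (∀ ω c, ∀ v ∈ A ω c, c v ∉ D) ∧
      (∀ ω c, ∃ ω', A₀ ω' ⊆ A ω c ∪ colorClass c D) ∧
      3 ^ D.card * ∑ ω, ∑ c, (A ω c).card ≤ ∑ ω, ∑ _c : V → C, (A₀ ω).card := by
  classical
  induction D using Finset.induction_on with
  | empty => exact ⟨fun ω _ => A₀ ω, by simp, by simp, by simp, fun ω _ => ⟨ω, by simp⟩, by simp⟩
  | insert d D hd ih =>
    obtain ⟨A, hsub, hinv, hdisj, hcov, hsize⟩ := ih
    choose τ hτA hτW hτex hτmin using fun (A : Ω → Finset V) W ω => exists_min_fragment A W ω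
    choose β hβ using fun (A : Ω → Finset V) W => exists_smallest_subset A W
    set T : Ω → (V → C) → Finset V := fun ω c => τ (fun ω => A ω c) (colorClass c {d}) ω with hT
    set B : (V → C) → Finset V := fun c => β (fun ω => A ω c) (colorClass c {d}) with hB
    have hTA : ∀ ω c, T ω c ⊆ A ω c := fun ω c => hτA _ _ _
    have hTD : ∀ ω c, ∀ v ∈ T ω c, c v ∉ D := fun ω c v hv => hdisj ω c v (hTA ω c hv)
    have hrec : ∀ ω c ω', A ω' (recolor c (T ω c) d) = A ω' c :=
      fun ω c ω' => hinv c _ d hd (hTD ω c) ω'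
    have hBspec : ∀ ω c, T ω c ⊆ B (recolor c (T ω c) d) ∧
        (B (recolor c (T ω c) d)).card ≤ (A ω c).card := by
      intro ω c
      obtain ⟨ω₁, h₁, h₁c⟩ := hτex (fun ω => A ω c) (colorClass c {d}) ω
      have hB' : B (recolor c (T ω c) d) = β (fun ω => A ω c) (T ω c ∪ colorClass c {d}) := by
        simp only [hB, hrec, colorClass_recolor_self]
      obtain ⟨⟨ω₂, h₂⟩, h₃, h₄⟩ := hβ (fun ω => A ω c) (T ω c ∪ colorClass c {d}) ⟨ω₁, h₁⟩
      rw [hB']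
      have hle := (h₄ ω₁ h₁).trans h₁c
      refine ⟨?_, hle⟩
      rw [← h₂] at h₃ hle ⊢
      have hm := hτmin (fun ω => A ω c) (colorClass c {d}) ω ω₂
        (h₃.trans (Finset.union_subset_union_left (hTA ω c))) hle
      have hs : A ω₂ c \ colorClass c {d} ⊆ T ω c := by
        intro v hv
        have hv' := Finset.mem_sdiff.1 hv
        exact (Finset.mem_union.1 (h₃ hv'.1)).resolve_right hv'.2
      rw [← Finset.eq_of_subset_of_card_le hs hm]
      exact Finset.sdiff_subset
    refine ⟨T, fun ω c => (hTA ω c).trans (hsub ω c), ?_, ?_, ?_, ?_⟩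
    · intro c S e he hS ω
      simp only [Finset.mem_insert, not_or] at he hS
      have h1 : ∀ ω, A ω (recolor c S e) = A ω c := hinv c S e he.2 fun v hv => (hS v hv).2
      have h2 : colorClass (recolor c S e) {d} = colorClass c {d} :=
        colorClass_recolor c S e {d} (by simpa using he.1) fun v hv => by simpa using (hS v hv).1
      simp only [hT, h1, h2]
    · intro ω c v hv
      rw [Finset.mem_insert, not_or]
      refine ⟨fun h => ?_, hTD ω c v hv⟩
      exact Finset.disjoint_left.1 (hτW (fun ω => A ω c) (colorClass c {d}) ω) hv
        (by simp [mem_colorClass, h])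
    · intro ω c
      obtain ⟨ω₁, h₁, -⟩ := hτex (fun ω => A ω c) (colorClass c {d}) ω
      obtain ⟨ω₂, h₂⟩ := hcov ω₁ c
      refine ⟨ω₂, fun v hv => ?_⟩
      have h3 := h₂ hv
      simp only [Finset.mem_union, mem_colorClass,
        Finset.mem_insert] at h3 ⊢
      rcases h3 with h3 | h3
      · have h4 := h₁ h3
        simp only [Finset.mem_union, mem_colorClass,
          Finset.mem_singleton] at h4
        rcases h4 with h4 | h4
        · exact Or.inl h4
        · exact Or.inr (Or.inl h4)
      · exact Or.inr (Or.inr h3)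
    · have hsp : ∀ c S, (Finset.univ.filter fun ω => S ⊆ A ω c).card *
          (8 * Fintype.card C) ^ S.card ≤ Fintype.card Ω := by
        intro c S
        refine le_trans (Nat.mul_le_mul_right _ (Finset.card_le_card ?_)) (hspread S)
        intro ω hω
        simp only [Finset.mem_filter, Finset.mem_univ, true_and] at hω ⊢
        exact hω.trans (hsub ω c)
      have h1 := sum_card_fragment_le A d hsp T B
        (fun ω c => by rw [hrec]; exact hTA ω c) (fun ω c => (hBspec ω c).1)
      have h2 : ∑ ω, ∑ c, (B (recolor c (T ω c) d)).card ≤ ∑ ω, ∑ c, (A ω c).card :=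
        Finset.sum_le_sum fun ω _ => Finset.sum_le_sum fun c _ => (hBspec ω c).2
      rw [Finset.card_insert_of_notMem hd, pow_succ, mul_assoc]
      exact le_trans (Nat.mul_le_mul_left _ (h1.trans h2)) hsize

/-- Spread lemma: a random colour class contains a member of a spread family, except with
small probability. -/
lemma card_bad_colorings_le {V C Ω : Type*} [Fintype V] [DecidableEq V] [Fintype C]
    [DecidableEq C] [Fintype Ω] [Nonempty Ω] (A₀ : Ω → Finset V) (k : ℕ)
    (hk : ∀ ω, (A₀ ω).card ≤ k)
    (hspread : ∀ S, (Finset.univ.filter fun ω => S ⊆ A₀ ω).card *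
      (8 * Fintype.card C) ^ S.card ≤ Fintype.card Ω) (D : Finset C) :
    3 ^ D.card * (Finset.univ.filter fun c : V → C => ∀ ω, ¬ A₀ ω ⊆ colorClass c D).card ≤
      Fintype.card (V → C) * k := by
  classical
  obtain ⟨A, -, -, -, hcov, hsize⟩ := exists_iterated_fragments A₀ hspread D
  set bad := Finset.univ.filter fun c : V → C => ∀ ω, ¬ A₀ ω ⊆ colorClass c D
  have h1 : bad.card * Fintype.card Ω ≤ ∑ ω, ∑ c, (A ω c).card := by
    rw [Finset.sum_comm, ← smul_eq_mul, ← Finset.sum_const]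
    refine le_trans (Finset.sum_le_sum fun c hc => ?_)
      (Finset.sum_le_sum_of_subset (Finset.subset_univ bad))
    rw [← Finset.card_univ, Finset.card_eq_sum_ones]
    refine Finset.sum_le_sum fun ω _ => Finset.card_pos.2 ?_
    rw [Finset.nonempty_iff_ne_empty]
    intro h
    obtain ⟨ω', h'⟩ := hcov ω c
    rw [h, Finset.empty_union] at h'
    exact (Finset.mem_filter.1 hc).2 ω' h'
  have h2 : ∑ ω, ∑ _c : V → C, (A₀ ω).card ≤ Fintype.card (V → C) * k * Fintype.card Ω := by
    calc _ ≤ ∑ _ω : Ω, ∑ _c : V → C, k :=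
          Finset.sum_le_sum fun ω _ => Finset.sum_le_sum fun c _ => hk ω
      _ = _ := by simp only [Finset.sum_const, Finset.card_univ, smul_eq_mul]; ring
  refine Nat.le_of_mul_le_mul_right ?_ (Fintype.card_pos (α := Ω))
  calc _ = 3 ^ D.card * (bad.card * Fintype.card Ω) := by ring
    _ ≤ _ := (Nat.mul_le_mul_left _ h1).trans (hsize.trans h2)

/-- The vertex set of a tuple, as a subset of `[k] × [n]`. -/
def tupleGraph {k n : ℕ} (x : Fin k → Fin n) : Finset (Fin k × Fin n) :=
  Finset.univ.filter fun p => x p.1 = p.2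

lemma mem_tupleGraph {k n : ℕ} {x : Fin k → Fin n} {p : Fin k × Fin n} :
    p ∈ tupleGraph x ↔ x p.1 = p.2 := by
  simp only [tupleGraph, Finset.mem_filter, Finset.mem_univ, true_and]

lemma card_tupleGraph {k n : ℕ} (x : Fin k → Fin n) : (tupleGraph x).card = k := by
  have : tupleGraph x = Finset.univ.image fun j => (j, x j) := by
    ext ⟨j, a⟩
    simp [mem_tupleGraph]
  rw [this, Finset.card_image_of_injective _ fun a b h => (Prod.mk.inj h).1]
  simp

lemma card_tuples_containing {k n : ℕ} (T : Finset (Fin k × Fin n)) :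
    (Finset.univ.filter fun x : Fin k → Fin n => T ⊆ tupleGraph x).card * n ^ T.card ≤ n ^ k := by
  classical
  have h1 : (Finset.univ.filter fun x : Fin k → Fin n => T ⊆ tupleGraph x) =
      Fintype.piFinset fun j => Finset.univ.filter fun a => ∀ p ∈ T, p.1 = j → a = p.2 := by
    ext x
    simp only [Finset.mem_filter, Finset.mem_univ, true_and, Fintype.mem_piFinset]
    constructor
    · rintro h j p hp rfl
      exact mem_tupleGraph.1 (h hp)
    · intro h p hp
      exact mem_tupleGraph.2 (h p.1 p hp rfl)
  have h2 : T.card = ∑ j, (T.filter fun p => p.1 = j).card :=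
    Finset.card_eq_sum_card_fiberwise fun _ _ => Finset.mem_univ _
  rw [h1, Fintype.card_piFinset, h2, ← Finset.prod_pow_eq_pow_sum, ← Finset.prod_mul_distrib]
  refine (Finset.prod_le_prod' (g := fun _ => n) fun j _ => ?_).trans (by simp)
  rcases Nat.lt_trichotomy (T.filter fun p => p.1 = j).card 1 with h | h | h
  · rw [Nat.lt_one_iff.1 h, pow_zero, mul_one]
    exact (Finset.card_le_univ _).trans (by simp)
  · rw [h, pow_one]
    obtain ⟨p, hp⟩ := Finset.card_eq_one.1 h
    have hp' : p ∈ T ∧ p.1 = j := by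
      have : p ∈ T.filter fun p => p.1 = j := by rw [hp]; simp
      simpa using this
    refine Nat.mul_le_of_le_div _ _ _ ?_ |>.trans (le_refl _)
    rw [Nat.div_self p.2.pos]
    refine Finset.card_le_one.2 fun a ha b hb => ?_
    simp only [Finset.mem_filter, Finset.mem_univ, true_and] at ha hb
    rw [ha p hp'.1 hp'.2, hb p hp'.1 hp'.2]
  · obtain ⟨p, hp, q, hq, hpq⟩ := Finset.one_lt_card.1 h
    simp only [Finset.mem_filter] at hp hq
    rw [Finset.card_eq_zero.2, zero_mul]
    · exact Nat.zero_le _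
    · refine Finset.eq_empty_of_forall_notMem fun a ha => hpq ?_
      simp only [Finset.mem_filter, Finset.mem_univ, true_and] at ha
      exact Prod.ext (hp.2.trans hq.2.symm) ((ha p hp.1 hp.2).symm.trans (ha q hq.1 hq.2))

/-- `S` has at most two elements and is the kernel of an `R`-spread subfamily of `F`. -/
def IsSpreadKernel {k n : ℕ} (R : ℕ) (F : Finset (Fin k → Fin n)) (S : Finset (Fin k × Fin n)) :
    Prop :=
  S.card ≤ 2 ∧ ∃ G ⊆ F, G.Nonempty ∧ (∀ x ∈ G, S ⊆ tupleGraph x) ∧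
    ∀ T, S ⊆ T → (G.filter fun x => T ⊆ tupleGraph x).card * R ^ T.card ≤ G.card * R ^ S.card

lemma IsSpreadKernel.mono {k n R : ℕ} {F F' : Finset (Fin k → Fin n)} {S : Finset (Fin k × Fin n)}
    (h : IsSpreadKernel R F S) (hF : F ⊆ F') : IsSpreadKernel R F' S := by
  obtain ⟨h2, G, hG, h3⟩ := h
  exact ⟨h2, G, hG.trans hF, h3⟩

lemma exists_isSpreadKernel {k n R : ℕ} (F : Finset (Fin k → Fin n)) (hR : R ≤ n)
    (hF : R ^ 3 * n ^ k < F.card * n ^ 3) :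
    ∃ S, IsSpreadKernel R F S ∧ ∃ x ∈ F, S ⊆ tupleGraph x := by
  classical
  obtain ⟨S, -, hS⟩ := Finset.exists_max_image (Finset.univ : Finset (Finset (Fin k × Fin n)))
    (fun S => (F.filter fun x => S ⊆ tupleGraph x).card * R ^ S.card) ⟨∅, Finset.mem_univ _⟩
  have hFS : F.card ≤ (F.filter fun x => S ⊆ tupleGraph x).card * R ^ S.card := by
    simpa using hS ∅ (Finset.mem_univ _)
  have hpos : 0 < F.card := Nat.pos_of_ne_zero fun h => by simp [h] at hF
  have hn : 0 < n := Nat.pos_of_ne_zero fun h => by simp [h] at hF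
  have hne : (F.filter fun x => S ⊆ tupleGraph x).Nonempty := by
    rw [← Finset.card_pos]
    exact Nat.pos_of_ne_zero fun h => by rw [h, zero_mul] at hFS; omega
  have hcard : S.card ≤ 2 := by
    by_contra! h
    obtain ⟨r, hr⟩ := Nat.exists_eq_add_of_le (show 3 ≤ S.card from h)
    have h1 : (F.filter fun x => S ⊆ tupleGraph x).card * n ^ S.card ≤ n ^ k :=
      (Nat.mul_le_mul_right _ (Finset.card_le_card
        (Finset.filter_subset_filter _ (Finset.subset_univ F)))).trans (card_tuples_containing S)
    have h2 : F.card * n ^ 3 * n ^ r ≤ R ^ 3 * n ^ k * n ^ r := calc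
      F.card * n ^ 3 * n ^ r = F.card * n ^ S.card := by rw [hr, pow_add, mul_assoc]
      _ ≤ (F.filter fun x => S ⊆ tupleGraph x).card * R ^ S.card * n ^ S.card :=
        Nat.mul_le_mul_right _ hFS
      _ = (F.filter fun x => S ⊆ tupleGraph x).card * n ^ S.card * R ^ S.card := by ring
      _ ≤ n ^ k * R ^ S.card := Nat.mul_le_mul_right _ h1
      _ = R ^ 3 * n ^ k * R ^ r := by rw [hr, pow_add]; ring
      _ ≤ _ := Nat.mul_le_mul_left _ (Nat.pow_le_pow_left hR r)
    exact absurd (Nat.le_of_mul_le_mul_right h2 (by positivity)) (not_le.2 hF)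
  obtain ⟨x, hx⟩ := hne
  refine ⟨S, ⟨hcard, F.filter fun x => S ⊆ tupleGraph x, Finset.filter_subset _ _, ⟨x, hx⟩,
    fun y hy => (Finset.mem_filter.1 hy).2, fun T hT => ?_⟩, x, Finset.mem_filter.1 hx⟩
  refine le_trans (Nat.mul_le_mul_right _ (Finset.card_le_card ?_)) (hS T (Finset.mem_univ _))
  exact Finset.filter_subset_filter _ (Finset.filter_subset _ _)

/-- Disjoint sets that can each be exchanged for a member of the respective family avoiding few
given vertices can be exchanged simultaneously. -/
lemma exists_disjoint_members {V : Type*} [DecidableEq V] {s : ℕ} (K : Fin s → Finset V → Prop)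
    (hK : ∀ i S, K i S → S.card ≤ 2) (C : Fin s → Finset V) (hC : ∀ i, (C i).card ≤ 2)
    (hdisj : ∀ i j, i ≠ j → Disjoint (C i) (C j))
    (hex : ∀ i X, X.card ≤ 2 * (s - 1) → Disjoint X (C i) → ∃ S, K i S ∧ Disjoint S X) :
    ∃ S : Fin s → Finset V, (∀ i, K i (S i)) ∧ ∀ i j, i ≠ j → Disjoint (S i) (S j) := by
  classical
  have main : ∀ P : Finset (Fin s), ∃ S : Fin s → Finset V, (∀ i ∈ P, K i (S i)) ∧
      (∀ i, (S i).card ≤ 2) ∧ (∀ i ∉ P, S i = C i) ∧ ∀ i j, i ≠ j → Disjoint (S i) (S j) := by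
    intro P
    induction P using Finset.induction_on with
    | empty => exact ⟨C, by simp, hC, by simp, hdisj⟩
    | insert a P ha ih =>
      obtain ⟨S, h1, h2, h3, h4⟩ := ih
      obtain ⟨Sa, hKa, hSa⟩ := hex a ((Finset.univ.erase a).biUnion S)
        ((Finset.card_biUnion_le_card_mul _ _ 2 fun i _ => h2 i).trans (by simp [mul_comm]))
        (by
          rw [← h3 a ha, Finset.disjoint_biUnion_left]
          exact fun i hi => h4 i a (Finset.ne_of_mem_erase hi))
      rw [Finset.disjoint_biUnion_right] at hSa
      have hSa' : ∀ i, i ≠ a → Disjoint Sa (S i) := fun i hi => hSa i (by simp [hi])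
      refine ⟨Function.update S a Sa, ?_, ?_, ?_, ?_⟩
      · intro i hi
        by_cases hia : i = a
        · subst hia; simpa using hKa
        · rw [Function.update_of_ne hia]
          exact h1 i (Finset.mem_of_mem_insert_of_ne hi hia)
      · intro i
        by_cases hia : i = a
        · subst hia; simpa using hK _ _ hKa
        · rw [Function.update_of_ne hia]; exact h2 i
      · intro i hi
        rw [Finset.mem_insert, not_or] at hi
        rw [Function.update_of_ne hi.1]; exact h3 i hi.2
      · intro i j hij
        by_cases hia : i = a
        · subst hia
          rw [Function.update_self, Function.update_of_ne hij.symm]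
          exact hSa' j hij.symm
        · by_cases hja : j = a
          · subst hja
            rw [Function.update_self, Function.update_of_ne hij]
            exact (hSa' i hij).symm
          · rw [Function.update_of_ne hia, Function.update_of_ne hja]; exact h4 i j hij
  obtain ⟨S, h1, -, -, h4⟩ := main Finset.univ
  exact ⟨S, fun i => h1 i (Finset.mem_univ i), h4⟩

lemma exists_system_of_representatives {V : Type*} [DecidableEq V] {s : ℕ}
    (J : Finset (Fin s)) (A : Fin s → Finset V) (hA : ∀ i ∈ J, (i : ℕ) < (A i).card) :
    ∃ v : J → V, Function.Injective v ∧ ∀ i : J, v i ∈ A i := by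
  classical
  refine (Finset.all_card_le_biUnion_card_iff_exists_injective fun i : J => A i).1 fun P => ?_
  rcases P.eq_empty_or_nonempty with rfl | hP
  · simp
  · obtain ⟨i, hi, hmax⟩ := Finset.exists_max_image P (fun i => ((i : Fin s) : ℕ)) hP
    calc P.card ≤ (Finset.range ((i : Fin s) + 1)).card := by
          refine Finset.card_le_card_of_injOn (fun i => ((i : Fin s) : ℕ)) ?_ ?_
          · intro j hj
            simpa [Nat.lt_succ_iff] using hmax j hj
          · intro a _ b _ hab
            exact Subtype.ext (Fin.ext hab)
      _ ≤ (A i).card := by rw [Finset.card_range]; exact hA i i.2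
      _ ≤ _ := Finset.card_le_card (Finset.subset_biUnion_of_mem (fun i : J => A i) hi)

/-- A family of tuples containing members of `K` is small if `K` has a small transversal and
has small transversals avoiding each vertex outside a small set `A`. -/
lemma card_mul_sq_le_of_transversals {k n r : ℕ} (K : Finset (Fin k × Fin n) → Prop)
    (U : Finset (Fin k → Fin n)) (hU : ∀ x ∈ U, ∃ S, K S ∧ S ⊆ tupleGraph x)
    (A X : Finset (Fin k × Fin n)) (hX : X.card ≤ r) (hKX : ∀ S, K S → ¬ Disjoint S X)
    (Y : Fin k × Fin n → Finset (Fin k × Fin n)) (hY : ∀ v ∉ A, (Y v).card ≤ r)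
    (hvY : ∀ v ∉ A, v ∉ Y v) (hKY : ∀ v ∉ A, ∀ S, K S → ¬ Disjoint S (Y v)) :
    U.card * n ^ 2 ≤ A.card * n ^ (k + 1) + r ^ 2 * n ^ k := by
  classical
  set star : Finset (Fin k × Fin n) → Finset (Fin k → Fin n) := fun T =>
    Finset.univ.filter fun x => T ⊆ tupleGraph x with hstar
  have hsub : U ⊆ (A.biUnion fun v => star {v}) ∪
      ((X.filter fun v => v ∉ A).biUnion fun v => (Y v).biUnion fun u => star {v, u}) := by
    intro x hx
    obtain ⟨S, hKS, hS⟩ := hU x hx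
    obtain ⟨v, hvS, hvX⟩ := Finset.not_disjoint_iff.1 (hKX S hKS)
    by_cases hvA : v ∈ A
    · refine Finset.mem_union_left _ (Finset.mem_biUnion.2 ⟨v, hvA, ?_⟩)
      simpa [hstar] using hS hvS
    · obtain ⟨u, huS, huY⟩ := Finset.not_disjoint_iff.1 (hKY v hvA S hKS)
      refine Finset.mem_union_right _ (Finset.mem_biUnion.2
        ⟨v, Finset.mem_filter.2 ⟨hvX, hvA⟩, Finset.mem_biUnion.2 ⟨u, huY, ?_⟩⟩)
      simp only [hstar, Finset.mem_filter, Finset.mem_univ, true_and, Finset.insert_subset_iff,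
        Finset.singleton_subset_iff]
      exact ⟨hS hvS, hS huS⟩
  have h1 : (A.biUnion fun v => star {v}).card * n ^ 2 ≤ A.card * n ^ (k + 1) := calc
    _ ≤ (∑ v ∈ A, (star {v}).card) * n ^ 2 := Nat.mul_le_mul_right _ Finset.card_biUnion_le
    _ = ∑ v ∈ A, (star {v}).card * n ^ 1 * n := by
      rw [Finset.sum_mul]; exact Finset.sum_congr rfl fun v _ => by ring
    _ ≤ ∑ v ∈ A, n ^ k * n := by
      refine Finset.sum_le_sum fun v _ => Nat.mul_le_mul_right _ ?_
      simpa [hstar] using card_tuples_containing ({v} : Finset (Fin k × Fin n))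
    _ = _ := by rw [Finset.sum_const, smul_eq_mul, pow_succ]
  have h2 : ((X.filter fun v => v ∉ A).biUnion fun v =>
      (Y v).biUnion fun u => star {v, u}).card * n ^ 2 ≤ r ^ 2 * n ^ k := calc
    _ ≤ (∑ v ∈ X.filter fun v => v ∉ A, ∑ u ∈ Y v, (star {v, u}).card) * n ^ 2 :=
      Nat.mul_le_mul_right _ (Finset.card_biUnion_le.trans
        (Finset.sum_le_sum fun v _ => Finset.card_biUnion_le))
    _ = ∑ v ∈ X.filter fun v => v ∉ A, ∑ u ∈ Y v, (star {v, u}).card * n ^ 2 := by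
      simp only [Finset.sum_mul]
    _ ≤ ∑ v ∈ X.filter fun v => v ∉ A, ∑ u ∈ Y v, n ^ k := by
      refine Finset.sum_le_sum fun v hv => Finset.sum_le_sum fun u hu => ?_
      have hvA := (Finset.mem_filter.1 hv).2
      have hne : v ≠ u := fun h => hvY v hvA (h ▸ hu)
      simpa [hstar, Finset.card_pair hne] using card_tuples_containing ({v, u} : Finset (Fin k × Fin n))
    _ ≤ ∑ v ∈ X.filter fun v => v ∉ A, r * n ^ k := by
      refine Finset.sum_le_sum fun v hv => ?_
      rw [Finset.sum_const, smul_eq_mul]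
      exact Nat.mul_le_mul_right _ (hY v (Finset.mem_filter.1 hv).2)
    _ ≤ _ := by
      rw [Finset.sum_const, smul_eq_mul, sq, mul_assoc]
      exact Nat.mul_le_mul_right _ ((Finset.card_le_card (Finset.filter_subset _ _)).trans hX)
  calc U.card * n ^ 2 ≤ _ := Nat.mul_le_mul_right _
        ((Finset.card_le_card hsub).trans (Finset.card_union_le _ _))
    _ ≤ _ := by rw [add_mul]; exact Nat.add_le_add h1 h2

/-- Large families have pairwise disjoint spread kernels. -/
lemma exists_disjoint_spreadKernels {s k n R : ℕ} (hR : R ≤ n)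
    (F : Fin s → Finset (Fin k → Fin n))
    (hF : ∀ i : Fin s, (i : ℕ) * n ^ (k + 2) + (2 * (s - 1)) ^ 2 * n ^ (k + 1) + R ^ 3 * n ^ k <
      (F i).card * n ^ 3) :
    ∃ S : Fin s → Finset (Fin k × Fin n), (∀ i, IsSpreadKernel R (F i) (S i)) ∧
      ∀ i j, i ≠ j → Disjoint (S i) (S j) := by
  classical
  set Q : Fin s → Finset (Fin k × Fin n) → Prop := fun i C =>
    ∀ X : Finset (Fin k × Fin n), X.card ≤ 2 * (s - 1) → Disjoint X C →
      ∃ S, IsSpreadKernel R (F i) S ∧ Disjoint S X with hQ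
  set A : Fin s → Finset (Fin k × Fin n) := fun i => Finset.univ.filter fun v => Q i {v} with hA
  set J : Finset (Fin s) := Finset.univ.filter fun i => ¬ Q i ∅ with hJ
  have hAJ : ∀ i ∈ J, (i : ℕ) < (A i).card := by
    intro i hi
    by_contra! hcard
    have hQi : ¬ Q i ∅ := (Finset.mem_filter.1 hi).2
    simp only [hQ] at hQi
    push Not at hQi
    obtain ⟨X, hX, -, hKX⟩ := hQi
    have hY : ∀ v ∉ A i, ∃ Y : Finset (Fin k × Fin n), Y.card ≤ 2 * (s - 1) ∧ v ∉ Y ∧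
        ∀ S, IsSpreadKernel R (F i) S → ¬ Disjoint S Y := by
      intro v hv
      have hv' : ¬ Q i {v} := by simpa [hA] using hv
      simp only [hQ] at hv'
      push Not at hv'
      obtain ⟨Y, hY, hdY, hKY⟩ := hv'
      exact ⟨Y, hY, Finset.disjoint_singleton_right.1 hdY, fun S hS => hKY S hS⟩
    choose! Y hY1 hY2 hY3 using hY
    have h1 := card_mul_sq_le_of_transversals (IsSpreadKernel R (F i))
      ((F i).filter fun x => ∃ S, IsSpreadKernel R (F i) S ∧ S ⊆ tupleGraph x)
      (fun x hx => (Finset.mem_filter.1 hx).2) (A i) X hX hKX Y hY1 hY2 hY3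
    have h2 : ((F i).filter fun x => ¬ ∃ S, IsSpreadKernel R (F i) S ∧ S ⊆ tupleGraph x).card *
        n ^ 3 ≤ R ^ 3 * n ^ k := by
      by_contra h
      obtain ⟨S, hS, x, hx, hSx⟩ := exists_isSpreadKernel _ hR (not_le.1 h)
      exact (Finset.mem_filter.1 hx).2 ⟨S, hS.mono (Finset.filter_subset _ _), hSx⟩
    have h3 := hF i
    have hsplit : ((F i).filter fun x => ∃ S, IsSpreadKernel R (F i) S ∧ S ⊆ tupleGraph x).card +
        ((F i).filter fun x => ¬ ∃ S, IsSpreadKernel R (F i) S ∧ S ⊆ tupleGraph x).card =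
        (F i).card := by
      convert Finset.card_filter_add_card_filter_not _
    rw [← hsplit, add_mul] at h3
    have h4 := Nat.mul_le_mul_right n h1
    have h5 : (A i).card * n ^ (k + 1) * n ≤ (i : ℕ) * n ^ (k + 2) := by
      rw [mul_assoc, ← pow_succ]; exact Nat.mul_le_mul_right _ hcard
    have h6 : ((A i).card * n ^ (k + 1) + (2 * (s - 1)) ^ 2 * n ^ k) * n =
      (A i).card * n ^ (k + 1) * n + (2 * (s - 1)) ^ 2 * n ^ (k + 1) := by ring
    rw [h6, mul_assoc, ← pow_succ] at h4
    norm_num only at h4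
    linarith
  obtain ⟨v, hvinj, hvA⟩ := exists_system_of_representatives J A hAJ
  refine exists_disjoint_members _ (fun i S hS => hS.1)
    (fun i => if h : i ∈ J then {v ⟨i, h⟩} else ∅) ?_ ?_ ?_
  · intro i
    split_ifs <;> simp
  · intro i j hij
    split_ifs with hi hj
    · rw [Finset.disjoint_singleton]
      exact fun h => hij (congrArg Subtype.val (hvinj h))
    all_goals simp
  · intro i
    by_cases hi : i ∈ J
    · have : Q i {v ⟨i, hi⟩} := (Finset.mem_filter.1 (hvA ⟨i, hi⟩)).2
      simpa only [hi, dif_pos] using this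
    · have : Q i ∅ := by simpa [hJ] using hi
      simpa only [hi, dif_neg, not_false_eq_true] using this

/-- A spread kernel `S` extends to a tuple of the family avoiding `X` whose other vertices lie in
a random colour class, except with small probability. -/
lemma card_bad_colorings_of_kernel_le {k n : ℕ} {C : Type*} [Fintype C] [DecidableEq C]
    (hC : 0 < Fintype.card C) (F : Finset (Fin k → Fin n)) (S X : Finset (Fin k × Fin n))
    (hS : IsSpreadKernel (16 * Fintype.card C) F S) (hSX : Disjoint S X)
    (hX : X.card ≤ 8 * Fintype.card C) (D : Finset C)
    (bad : Finset (Fin k × Fin n → C))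
    (hbad : ∀ c ∈ bad, ∀ x ∈ F, S ⊆ tupleGraph x → Disjoint (tupleGraph x) X →
      ¬ tupleGraph x \ S ⊆ colorClass c D) :
    3 ^ D.card * bad.card ≤ Fintype.card (Fin k × Fin n → C) * k := by
  classical
  obtain ⟨-, G, hGF, hGne, hGS, hspread⟩ := hS
  set R := 16 * Fintype.card C with hR
  have hR0 : 0 < R := by omega
  have hext : ∀ T, Disjoint S T →
      (G.filter fun x => T ⊆ tupleGraph x).card * R ^ T.card ≤ G.card := by
    intro T hT
    have h := hspread (S ∪ T) Finset.subset_union_left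
    rw [Finset.card_union_of_disjoint hT, pow_add] at h
    have hfil : (G.filter fun x => S ∪ T ⊆ tupleGraph x) = G.filter fun x => T ⊆ tupleGraph x := by
      refine Finset.filter_congr fun x hx => ?_
      simp [Finset.union_subset_iff, hGS x hx]
    rw [hfil] at h
    refine Nat.le_of_mul_le_mul_right (c := R ^ S.card) ?_ (by positivity)
    calc _ = (G.filter fun x => T ⊆ tupleGraph x).card * (R ^ S.card * R ^ T.card) := by ring
      _ ≤ _ := h
  set G' := G.filter fun x => Disjoint (tupleGraph x) X with hG'
  have hmeet : (G.filter fun x => ¬ Disjoint (tupleGraph x) X).card * R ≤ X.card * G.card := by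
    have hsub : (G.filter fun x => ¬ Disjoint (tupleGraph x) X) ⊆
        X.biUnion fun v => G.filter fun x => {v} ⊆ tupleGraph x := by
      intro x hx
      obtain ⟨hxG, hx⟩ := Finset.mem_filter.1 hx
      obtain ⟨v, hv, hvX⟩ := Finset.not_disjoint_iff.1 hx
      exact Finset.mem_biUnion.2 ⟨v, hvX, Finset.mem_filter.2 ⟨hxG, by simpa using hv⟩⟩
    calc _ ≤ (∑ v ∈ X, (G.filter fun x => {v} ⊆ tupleGraph x).card) * R :=
          Nat.mul_le_mul_right _ ((Finset.card_le_card hsub).trans Finset.card_biUnion_le)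
      _ = ∑ v ∈ X, (G.filter fun x => {v} ⊆ tupleGraph x).card * R ^ 1 := by
        rw [Finset.sum_mul]; simp
      _ ≤ ∑ v ∈ X, G.card := Finset.sum_le_sum fun v hv => by
        simpa using hext {v} (Finset.disjoint_singleton_right.2 fun h =>
          Finset.disjoint_left.1 hSX h hv)
      _ = _ := by rw [Finset.sum_const, smul_eq_mul]
  have hG2 : G.card ≤ 2 * G'.card := by
    have h1 : G'.card + (G.filter fun x => ¬ Disjoint (tupleGraph x) X).card = G.card := by
      convert Finset.card_filter_add_card_filter_not _
    have h2 : 2 * (G.filter fun x => ¬ Disjoint (tupleGraph x) X).card ≤ G.card := by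
      refine Nat.le_of_mul_le_mul_right (c := 8 * Fintype.card C) ?_ (by omega)
      calc _ = (G.filter fun x => ¬ Disjoint (tupleGraph x) X).card * R := by rw [hR]; ring
        _ ≤ X.card * G.card := hmeet
        _ ≤ 8 * Fintype.card C * G.card := Nat.mul_le_mul_right _ hX
        _ = _ := mul_comm _ _
    omega
  have hne : G'.Nonempty := by
    have := hGne.card_pos
    exact Finset.card_pos.1 (by omega)
  have : Nonempty G' := hne.to_subtype
  have hA := card_bad_colorings_le (fun x : G' => tupleGraph x.1 \ S) k
    (fun x => (Finset.card_le_card Finset.sdiff_subset).trans (card_tupleGraph _).le)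
    (C := C) (fun T => by
      by_cases hST : Disjoint S T
      · have h1 : (Finset.univ.filter fun x : G' => T ⊆ tupleGraph x.1 \ S).card ≤
            (G.filter fun x => T ⊆ tupleGraph x).card := by
          refine Finset.card_le_card_of_injOn Subtype.val ?_ Subtype.val_injective.injOn
          intro x hx
          have hx' : T ⊆ tupleGraph x.1 \ S := by simpa using hx
          simp only [Finset.coe_filter, Set.mem_ofPred_eq]
          exact ⟨(Finset.mem_filter.1 x.2).1, hx'.trans Finset.sdiff_subset⟩
        rw [Fintype.card_coe]
        rcases T.eq_empty_or_nonempty with rfl | hT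
        · simp
        · refine le_of_mul_le_mul_left (?_ : 2 ^ T.card * _ ≤ 2 ^ T.card * _) (by positivity)
          calc _ = (Finset.univ.filter fun x : G' => T ⊆ tupleGraph x.1 \ S).card *
                R ^ T.card := by
                rw [hR, show 16 * Fintype.card C = 2 * (8 * Fintype.card C) by ring,
                  mul_pow 2]
                ring
            _ ≤ G.card := (Nat.mul_le_mul_right _ h1).trans (hext T hST)
            _ ≤ 2 * G'.card := hG2
            _ ≤ _ := Nat.mul_le_mul_right _ (Nat.le_self_pow hT.card_pos.ne' 2)
      · rw [Finset.card_eq_zero.2, zero_mul]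
        · exact Nat.zero_le _
        · refine Finset.eq_empty_of_forall_notMem fun x hx => hST ?_
          simp only [Finset.mem_filter, Finset.mem_univ, true_and] at hx
          exact Finset.disjoint_right.2 fun v hv => (Finset.mem_sdiff.1 (hx hv)).2) D
  refine le_trans (Nat.mul_le_mul_left _ (Finset.card_le_card fun c hc => ?_)) hA
  refine Finset.mem_filter.2 ⟨Finset.mem_univ _, fun x => ?_⟩
  have hx := Finset.mem_filter.1 x.2
  exact hbad c hc x.1 (hGF hx.1) (hGS x.1 hx.1) hx.2

/-- Families with pairwise disjoint spread kernels contain a rainbow matching. -/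
lemma exists_rainbow_of_disjoint_spreadKernels {s k n m : ℕ} (hs : 1 ≤ s) (hm : 1 ≤ m)
    (hsk : s * k < 3 ^ m) (F : Fin s → Finset (Fin k → Fin n))
    (S : Fin s → Finset (Fin k × Fin n))
    (hS : ∀ i, IsSpreadKernel (16 * (s * m)) (F i) (S i))
    (hdisj : ∀ i j, i ≠ j → Disjoint (S i) (S j)) :
    ∃ g : Fin s → (Fin k → Fin n), (∀ i, g i ∈ F i) ∧
      ∀ i i', i ≠ i' → ∀ j, g i j ≠ g i' j := by
  classical
  have hcard : Fintype.card (Fin s × Fin m) = s * m := by simp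
  set X : Fin s → Finset (Fin k × Fin n) := fun i => (Finset.univ.erase i).biUnion S with hXdef
  set D : Fin s → Finset (Fin s × Fin m) := fun i => {i} ×ˢ Finset.univ with hD
  set good : Fin s → (Fin k × Fin n → Fin s × Fin m) → Prop := fun i c =>
    ∃ x ∈ F i, S i ⊆ tupleGraph x ∧ Disjoint (tupleGraph x) (X i) ∧
      tupleGraph x \ S i ⊆ colorClass c (D i) with hgood
  have hDc : ∀ i, (D i).card = m := fun i => by simp [hD]
  have hsm : s ≤ s * m := Nat.le_mul_of_pos_right s hm
  have hXc : ∀ i, (X i).card ≤ 8 * Fintype.card (Fin s × Fin m) := by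
    intro i
    have : (X i).card ≤ (Finset.univ.erase i).card * 2 :=
      Finset.card_biUnion_le_card_mul _ _ 2 fun j _ => (hS j).1
    rw [Finset.card_erase_of_mem (Finset.mem_univ i), Finset.card_univ, Fintype.card_fin] at this
    omega
  have hb : ∀ i, 3 ^ m * (Finset.univ.filter fun c => ¬ good i c).card ≤
      Fintype.card (Fin k × Fin n → Fin s × Fin m) * k := by
    intro i
    conv_lhs => rw [← congrArg (fun a => 3 ^ a) (hDc i)]
    refine card_bad_colorings_of_kernel_le (by omega) (F i) (S i) (X i) (by rw [hcard]; exact hS i)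
      ?_ (hXc i) (D i) _ ?_
    · exact (Finset.disjoint_biUnion_right _ _ _).2 fun j hj =>
        hdisj i j (Finset.ne_of_mem_erase hj).symm
    · intro c hc x hx h1 h2 h3
      exact (Finset.mem_filter.1 hc).2 ⟨x, hx, h1, h2, h3⟩
  have hgoodc : ∃ c, ∀ i, good i c := by
    by_contra! hcon
    have hne : Nonempty (Fin k × Fin n → Fin s × Fin m) := ⟨fun _ => (⟨0, hs⟩, ⟨0, hm⟩)⟩
    have hpos : 0 < Fintype.card (Fin k × Fin n → Fin s × Fin m) := Fintype.card_pos
    have h1 : Fintype.card (Fin k × Fin n → Fin s × Fin m) ≤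
        ∑ i, (Finset.univ.filter fun c => ¬ good i c).card := by
      rw [← Finset.card_univ]
      refine le_trans (Finset.card_le_card fun c _ => ?_) Finset.card_biUnion_le
      obtain ⟨i, hi⟩ := hcon c
      exact Finset.mem_biUnion.2 ⟨i, Finset.mem_univ i, Finset.mem_filter.2 ⟨Finset.mem_univ c, hi⟩⟩
    have h2 : 3 ^ m * Fintype.card (Fin k × Fin n → Fin s × Fin m) ≤
        s * k * Fintype.card (Fin k × Fin n → Fin s × Fin m) := calc
      _ ≤ ∑ i, 3 ^ m * (Finset.univ.filter fun c => ¬ good i c).card := by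
        rw [← Finset.mul_sum]; exact Nat.mul_le_mul_left _ h1
      _ ≤ ∑ _i : Fin s, Fintype.card (Fin k × Fin n → Fin s × Fin m) * k :=
        Finset.sum_le_sum fun i _ => hb i
      _ = _ := by
        simp only [Finset.sum_const, Finset.card_univ, Fintype.card_fin, smul_eq_mul]; ring
    exact absurd (Nat.le_of_mul_le_mul_right h2 hpos) (not_le.2 hsk)
  obtain ⟨c, hc⟩ := hgoodc
  choose g hgF hgS hgX hgD using hc
  refine ⟨g, hgF, fun i i' hii' j hj => ?_⟩
  have h1 : (j, g i j) ∈ tupleGraph (g i) := mem_tupleGraph.2 rfl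
  have h2 : (j, g i j) ∈ tupleGraph (g i') := mem_tupleGraph.2 hj.symm
  have hnot : ∀ a b, a ≠ b → (j, g i j) ∈ tupleGraph (g a) → (j, g i j) ∉ S b :=
    fun a b hab ha hb => Finset.disjoint_left.1 (hgX a) ha
      (Finset.mem_biUnion.2 ⟨b, by simp [hab.symm], hb⟩)
  have h3 := mem_colorClass.1 (hgD i (Finset.mem_sdiff.2 ⟨h1, hnot i' i hii'.symm h2⟩))
  have h4 := mem_colorClass.1 (hgD i' (Finset.mem_sdiff.2 ⟨h2, hnot i i' hii' h1⟩))
  simp only [hD, Finset.mem_product, Finset.mem_singleton, Finset.mem_univ, and_true] at h3 h4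
  exact hii' (h3.symm.trans h4)

/-- Theorem 3.2: for `n > 2^5 s log₂(sk)`, the sequence
`f_i = (i-1)n^{k-1} + 4(s-1)²n^{k-2} + 2^{15}s³(log₂(sk))³n^{k-3}` is satisfying. -/
theorem stmt7 (s k n : ℕ) (hs : 2 ≤ s) (hk : 1 ≤ k)
    (hn : 2 ^ 5 * (s : ℝ) * Real.logb 2 ((s : ℝ) * (k : ℝ)) < (n : ℝ))
    (F : Fin s → Finset (Fin k → Fin n))
    (hF : ∀ i : Fin s,
      ((i : ℕ) : ℝ) * (n : ℝ) ^ ((k : ℤ) - 1) +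
        4 * ((s : ℝ) - 1) ^ 2 * (n : ℝ) ^ ((k : ℤ) - 2) +
        2 ^ 15 * (s : ℝ) ^ 3 * (Real.logb 2 ((s : ℝ) * (k : ℝ))) ^ 3 * (n : ℝ) ^ ((k : ℤ) - 3) <
        ((F i).card : ℝ)) :
    ∃ g : Fin s → (Fin k → Fin n), (∀ i, g i ∈ F i) ∧
      ∀ i i', i ≠ i' → ∀ j, g i j ≠ g i' j := by
  have hs0 : (2 : ℝ) ≤ s := by exact_mod_cast hs
  have hsk2 : 2 ≤ s * k := le_trans hs (Nat.le_mul_of_pos_right s hk)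
  set L := Real.logb 2 ((s : ℝ) * (k : ℝ)) with hL
  set m := Nat.clog 2 (s * k) with hm
  have hL1 : 1 ≤ L := by
    rw [hL, Real.le_logb_iff_rpow_le (by norm_num) (by positivity), Real.rpow_one]
    exact_mod_cast hsk2
  have hmL : (m : ℝ) ≤ 2 * L := by
    have h1 : ⌈L⌉₊ = m := by
      rw [hL, hm, ← Nat.cast_mul]
      exact_mod_cast Real.natCeil_logb_natCast 2 (s * k)
    have h2 := Nat.ceil_lt_add_one (zero_le_one.trans hL1)
    rw [h1] at h2
    linarith
  have hm1 : 1 ≤ m := Nat.clog_pos (by norm_num) hsk2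
  have hsk3 : s * k < 3 ^ m :=
    (Nat.le_pow_clog (by norm_num) _).trans_lt (Nat.pow_lt_pow_left (by norm_num) (by omega))
  have hRL : ((16 * (s * m) : ℕ) : ℝ) ≤ 2 ^ 5 * s * L := by
    push_cast
    nlinarith
  have hRn : 16 * (s * m) ≤ n := by exact_mod_cast (hRL.trans_lt hn).le
  have hn0 : (0 : ℝ) < n := lt_of_le_of_lt (by positivity) hn
  have hFnat : ∀ i : Fin s, (i : ℕ) * n ^ (k + 2) + (2 * (s - 1)) ^ 2 * n ^ (k + 1) +
      (16 * (s * m)) ^ 3 * n ^ k < (F i).card * n ^ 3 := by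
    intro i
    have h1 := mul_lt_mul_of_pos_right (hF i) (pow_pos hn0 3)
    have e : ∀ a b : ℕ, a + b = 3 → (n : ℝ) ^ ((k : ℤ) - a) * (n : ℝ) ^ 3 = (n : ℝ) ^ (k + b) := by
      intro a b hab
      rw [← zpow_natCast, ← zpow_natCast, ← zpow_add₀ hn0.ne']
      congr 1
      push_cast
      omega
    have e1 := e 1 2 rfl
    have e2 := e 2 1 rfl
    have e3 := e 3 0 rfl
    rw [Nat.cast_one] at e1
    rw [Nat.cast_ofNat] at e2 e3
    rw [add_mul, add_mul, mul_assoc, e1, mul_assoc _ _ ((n : ℝ) ^ 3), e2,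
      mul_assoc _ _ ((n : ℝ) ^ 3), e3, add_zero] at h1
    have h2 : ((16 * (s * m) : ℕ) : ℝ) ^ 3 * (n : ℝ) ^ k ≤ 2 ^ 15 * (s : ℝ) ^ 3 * L ^ 3 * n ^ k := by
      refine mul_le_mul_of_nonneg_right ?_ (by positivity)
      calc _ ≤ (2 ^ 5 * (s : ℝ) * L) ^ 3 := pow_le_pow_left₀ (by positivity) hRL 3
        _ = _ := by ring
    have h3 : ((2 * (s - 1) : ℕ) : ℝ) ^ 2 = 4 * ((s : ℝ) - 1) ^ 2 := by
      rw [Nat.cast_mul, Nat.cast_sub (by omega)]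
      push_cast
      ring
    have h4 : ((i : ℕ) : ℝ) * (n : ℝ) ^ (k + 2) + ((2 * (s - 1) : ℕ) : ℝ) ^ 2 * (n : ℝ) ^ (k + 1) +
        ((16 * (s * m) : ℕ) : ℝ) ^ 3 * (n : ℝ) ^ k < ((F i).card : ℝ) * (n : ℝ) ^ 3 := by
      rw [h3]
      linarith
    exact_mod_cast h4
  obtain ⟨S, hS, hdisj⟩ := exists_disjoint_spreadKernels hRn F hFnat
  exact exists_rainbow_of_disjoint_spreadKernels (by omega) hm1 hsk3 F S hS hdisj
end

section
/- Let s ≥ 2 and k ≥ 3 be integers, let r = 2^5 · s · log₂(sk), and let n > r be an integer. Identify each tuple x ∈ [n]^k with the k-element subset {(j, x_j) : j ∈ [k]} of the ground set [k]×[n]. If F_1, …, F_s ⊆ [n]^k are cross-dependent, then there exist families S_1, …, S_s of subsets of [k]×[n], each member having at most 2 elements, and subfamilies F_1' ⊆ F_1, …, F_s' ⊆ F_s, such that: (1) for every i ∈ [s], every F ∈ F_i either contains some member S ∈ S_i (as a subset of [k]×[n]) or belongs to F_i'; (2) |F_i'| ≤ r³·n^{k−3} for every i ∈ [s]; (3)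 the families S_1, …, S_s are cross-dependent, i.e., there is no choice of pairwise disjoint sets B_1 ∈ S_1, …, B_s ∈ S_s; (4) for every i ∈ [s], the number of 2-element members of S_i is at most 4(s−1)². -/
section
open Finset

/-- The probability of the outcome `W` when each point is kept independently with probability `p`. -/
def bernoulliWeight {α : Type*} [Fintype α] [DecidableEq α] (p : ℝ) (W : Finset α) : ℝ :=
  p ^ #W * (1 - p) ^ #Wᶜ

section
variable {α : Type*} [Fintype α] [DecidableEq α]

theorem bernoulliWeight_nonneg {p : ℝ} (h0 : 0 ≤ p) (h1 : p ≤ 1) (W : Finset α) :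
    0 ≤ bernoulliWeight p W :=
  mul_nonneg (pow_nonneg h0 _) (pow_nonneg (by linarith) _)

theorem sum_bernoulliWeight (p : ℝ) : ∑ W : Finset α, bernoulliWeight p W = 1 := by
  have h := Fintype.sum_pow_mul_eq_add_pow α p (1 - p)
  simpa [bernoulliWeight, card_compl] using h

theorem sum_bernoulliWeight_insert (p : ℝ) (x : α) (g : Finset α → ℝ) :
    p * ∑ V : Finset α, bernoulliWeight p V * g (insert x V) =
      ∑ V : Finset α, bernoulliWeight p V * if x ∈ V then g V else 0 := by
  have split (f : Finset α → ℝ) : ∑ V : Finset α, f V =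
      ∑ V ∈ (univ.erase x).powerset, (f V + f (insert x V)) := by
    rw [sum_add_distrib, ← sum_powerset_insert (notMem_erase x univ) f,
      insert_erase (mem_univ x), powerset_univ]
  rw [split, split, mul_sum]
  refine sum_congr rfl fun V hV => ?_
  have hx : x ∉ V := fun h => notMem_erase x univ (mem_powerset.mp hV h)
  have hc : #Vᶜ = #(insert x V)ᶜ + 1 := by
    rw [compl_insert, card_erase_add_one (by simpa using hx)]
  simp only [bernoulliWeight, hc, card_insert_of_notMem hx, insert_idem, hx, if_false,
    mem_insert_self, if_true]
  ring

theorem sum_bernoulliWeight_union (p : ℝ) (T : Finset α) (g : Finset α → ℝ) :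
    p ^ #T * ∑ V : Finset α, bernoulliWeight p V * g (V ∪ T) =
      ∑ V : Finset α, bernoulliWeight p V * if T ⊆ V then g V else 0 := by
  induction T using Finset.induction_on generalizing g with
  | empty => simp
  | insert x T hx ih =>
    have h := sum_bernoulliWeight_insert p x fun V => g (V ∪ T)
    simp only [insert_union] at h
    simp only [union_insert]
    rw [card_insert_of_notMem hx, pow_succ, mul_assoc, h]
    have h2 := ih fun V => if x ∈ V then g V else 0
    simp only [mem_union, hx, or_false] at h2
    rw [h2]
    refine sum_congr rfl fun V _ => ?_
    simp only [insert_subset_iff]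
    by_cases h1 : x ∈ V <;> by_cases h2 : T ⊆ V <;> simp [h1, h2]

theorem sum_bernoulliWeight_superset (p : ℝ) (T : Finset α) :
    ∑ V : Finset α, bernoulliWeight p V * (if T ⊆ V then 1 else 0) = p ^ #T := by
  rw [← sum_bernoulliWeight_union p T fun _ => 1]
  simp [sum_bernoulliWeight]

/-- The union of independent `q`-random and `p`-random sets is a `(q + p - q p)`-random set. -/
theorem sum_sum_bernoulliWeight_union {p : ℝ} (hp : p ≠ 0) (q : ℝ) (g : Finset α → ℝ) :
    ∑ W : Finset α, bernoulliWeight q W * ∑ V : Finset α, bernoulliWeight p V * g (V ∪ W) =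
      ∑ Z : Finset α, bernoulliWeight (1 - (1 - q) * (1 - p)) Z * g Z := by
  have h (W : Finset α) : bernoulliWeight q W * ∑ V, bernoulliWeight p V * g (V ∪ W) =
      ∑ Z, bernoulliWeight q W * (p ^ #W)⁻¹ *
        (bernoulliWeight p Z * if W ⊆ Z then g Z else 0) := by
    rw [← mul_sum, ← sum_bernoulliWeight_union]
    field_simp
  simp_rw [h]
  rw [sum_comm]
  refine sum_congr rfl fun Z _ => ?_
  have hZ : ∑ W : Finset α, bernoulliWeight q W * (p ^ #W)⁻¹ *
        (bernoulliWeight p Z * if W ⊆ Z then g Z else 0) =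
      ∑ W ∈ Z.powerset, (q / p) ^ #W * (1 - q) ^ (#Z - #W) *
        ((1 - q) ^ #Zᶜ * bernoulliWeight p Z * g Z) := by
    rw [← sum_filter_add_sum_filter_not univ (· ⊆ Z)]
    rw [sum_eq_zero (s := univ.filter (¬ · ⊆ Z)), add_zero]
    · refine sum_congr (by ext; simp) fun W hW => ?_
      have hW' : W ⊆ Z := by simpa using hW
      have hc : #Wᶜ = (#Z - #W) + #Zᶜ := by
        have := card_le_card hW'
        have := card_le_univ Z
        rw [card_compl, card_compl]; omega
      rw [if_pos hW', bernoulliWeight, hc, pow_add, div_pow]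
      ring
    · intro W hW
      rw [if_neg (mem_filter.mp hW).2]; simp
  rw [hZ, ← sum_mul, sum_pow_mul_eq_add_pow]
  have e1 : q / p + (1 - q) = (1 - (1 - q) * (1 - p)) / p := by field_simp; ring
  have e2 : 1 - (1 - (1 - q) * (1 - p)) = (1 - q) * (1 - p) := by ring
  rw [e1, bernoulliWeight, bernoulliWeight, e2, div_pow, mul_pow]
  field_simp

/-- A colour class of a uniformly random colouring with `s` colours is a `1 / s`-random set. -/
theorem sum_colorClass {s : ℕ} (i : Fin s) (g : Finset α → ℝ) :
    ∑ c : α → Fin s, g {x | c x = i} =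
      (s : ℝ) ^ Fintype.card α * ∑ W : Finset α, bernoulliWeight (1 / s : ℝ) W * g W := by
  have hs : (s : ℝ) ≠ 0 := by exact_mod_cast (i.pos).ne'
  rw [← sum_fiberwise univ (fun c : α → Fin s => ({x | c x = i} : Finset α)), mul_sum]
  refine sum_congr rfl fun W _ => ?_
  have hfib : ({c : α → Fin s | ({x | c x = i} : Finset α) = W} : Finset (α → Fin s)) =
      Fintype.piFinset fun x => if x ∈ W then {i} else univ.erase i := by
    ext c
    simp only [mem_filter, mem_univ, true_and, Fintype.mem_piFinset, Finset.ext_iff]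
    refine forall_congr' fun x => ?_
    by_cases hx : x ∈ W <;> simp [hx]
  have hcard : (#({c : α → Fin s | ({x | c x = i} : Finset α) = W} : Finset (α → Fin s)) : ℝ) =
      ((s : ℝ) - 1) ^ #Wᶜ := by
    rw [hfib, Fintype.card_piFinset, ← prod_mul_prod_compl W]
    rw [prod_congr rfl (g := fun _ => 1), prod_congr (s₁ := Wᶜ) rfl (g := fun _ => s - 1)]
    · rw [prod_const_one, prod_const, one_mul, Nat.cast_pow, Nat.cast_sub i.pos, Nat.cast_one]
    · intro x hx; rw [if_neg (mem_compl.mp hx), card_erase_of_mem (mem_univ _), card_univ,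
        Fintype.card_fin]
    · intro x hx; rw [if_pos hx, card_singleton]
  rw [sum_congr rfl (g := fun _ => g W) (fun c hc => by rw [(mem_filter.mp hc).2]), sum_const,
    nsmul_eq_mul, hcard, bernoulliWeight, ← card_add_card_compl W, pow_add,
    show (1 : ℝ) - 1 / s = (s - 1) / s by field_simp, div_pow, div_pow]
  simp only [one_pow]
  field_simp

/-- Two members of a spread family lying in a common random set `Z`, drawn independently given
`Z`, have a small expected overlap. -/
theorem sum_overlap_le {ι : Type*} {Ω : Finset ι} (hΩ : Ω.Nonempty) (T : ι → Finset α)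
    {r p : ℝ} (hr : 0 < r) (hp0 : 0 < p) (hp1 : p ≤ 1)
    (hspread : ∀ X, r ^ #X * #{a ∈ Ω | X ⊆ T a} ≤ #Ω) :
    Real.log (r * p) * ∑ Z, bernoulliWeight p Z *
        ((∑ a ∈ Ω with T a ⊆ Z, ∑ b ∈ Ω with T b ⊆ Z,
          (p ^ #(T a))⁻¹ * (p ^ #(T b))⁻¹ * #(T a ∩ T b)) /
            ∑ b ∈ Ω with T b ⊆ Z, (p ^ #(T b))⁻¹) ≤
      Real.log 2 * ∑ a ∈ Ω, (#(T a) : ℝ) := by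
  have hm : (0 : ℝ) < #Ω := by exact_mod_cast hΩ.card_pos
  set m : ℝ := (#Ω : ℝ)
  set w : ι → ℝ := fun a => (p ^ #(T a))⁻¹ with hw
  have hwpos (a) : 0 < w a := by positivity
  have key (Z : Finset α) : Real.log (r * p) *
        ((∑ a ∈ Ω with T a ⊆ Z, ∑ b ∈ Ω with T b ⊆ Z, w a * w b * #(T a ∩ T b)) /
            ∑ b ∈ Ω with T b ⊆ Z, w b) ≤
      Real.log 2 * ∑ a ∈ Ω with T a ⊆ Z, w a * #(T a) +
      m⁻¹ * (∑ a ∈ Ω with T a ⊆ Z, ∑ b ∈ Ω with T b ⊆ Z,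
        w a * w b * ((r * p) ^ #(T a ∩ T b) / 2 ^ #(T a))) + m -
      2 * ∑ a ∈ Ω with T a ⊆ Z, w a := by
    set N := ∑ a ∈ Ω with T a ⊆ Z, w a with hN
    obtain h0 | hne := (Ω.filter fun a => T a ⊆ Z).eq_empty_or_nonempty
    · simp only [h0, sum_empty, N]; simp; positivity
    have hNpos : 0 < N := sum_pos (fun a _ => hwpos a) hne
    have hpair (a b : ι) : Real.log (r * p) * #(T a ∩ T b) ≤ Real.log 2 * #(T a) +
        N / m * ((r * p) ^ #(T a ∩ T b) / 2 ^ #(T a)) + m / N - 2 := by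
      have h1 := Real.log_le_sub_one_of_pos
        (show 0 < N / m * ((r * p) ^ #(T a ∩ T b) / 2 ^ #(T a)) by positivity)
      have h2 := Real.log_le_sub_one_of_pos (show 0 < m / N by positivity)
      rw [Real.log_mul (by positivity) (by positivity), Real.log_div (by positivity)
        (by positivity), Real.log_div (by positivity) (by positivity), Real.log_pow,
        Real.log_pow] at h1
      rw [Real.log_div (by positivity) (by positivity)] at h2
      linarith
    have hsum : ∑ a ∈ Ω with T a ⊆ Z, ∑ b ∈ Ω with T b ⊆ Z,
          w a * w b * (Real.log (r * p) * #(T a ∩ T b)) ≤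
        ∑ a ∈ Ω with T a ⊆ Z, ∑ b ∈ Ω with T b ⊆ Z,
          w a * w b * (Real.log 2 * #(T a) +
            N / m * ((r * p) ^ #(T a ∩ T b) / 2 ^ #(T a)) + m / N - 2) :=
      sum_le_sum fun a _ => sum_le_sum fun b _ =>
        mul_le_mul_of_nonneg_left (hpair a b) (mul_pos (hwpos a) (hwpos b)).le
    have hR : ∑ a ∈ Ω with T a ⊆ Z, ∑ b ∈ Ω with T b ⊆ Z,
          w a * w b * (Real.log 2 * #(T a) +
            N / m * ((r * p) ^ #(T a ∩ T b) / 2 ^ #(T a)) + m / N - 2) =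
        N * (Real.log 2 * ∑ a ∈ Ω with T a ⊆ Z, w a * #(T a) +
      m⁻¹ * (∑ a ∈ Ω with T a ⊆ Z, ∑ b ∈ Ω with T b ⊆ Z,
        w a * w b * ((r * p) ^ #(T a ∩ T b) / 2 ^ #(T a))) + m - 2 * N) := by
      have e (a b : ι) : w a * w b * (Real.log 2 * #(T a) +
            N / m * ((r * p) ^ #(T a ∩ T b) / 2 ^ #(T a)) + m / N - 2) =
          Real.log 2 * (w a * #(T a)) * w b + N * m⁻¹ *
            (w a * w b * ((r * p) ^ #(T a ∩ T b) / 2 ^ #(T a))) + (m / N - 2) * w a * w b := by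
        ring
      simp only [e, sum_add_distrib, ← mul_sum, ← sum_mul, ← hN]
      field_simp
      ring
    rw [mul_div_assoc', div_le_iff₀ hNpos, mul_comm _ N, ← hR]
    refine le_trans (le_of_eq ?_) hsum
    simp only [mul_sum]
    exact sum_congr rfl fun a _ => sum_congr rfl fun b _ => by ring
  have hmain := sum_le_sum fun Z (_ : Z ∈ (univ : Finset (Finset α))) =>
    mul_le_mul_of_nonneg_left (key Z) (bernoulliWeight_nonneg hp0.le hp1 Z)
  have mean (f : ι → ℝ) : ∑ Z, bernoulliWeight p Z * ∑ a ∈ Ω with T a ⊆ Z, w a * f a =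
      ∑ a ∈ Ω, f a := by
    simp only [sum_filter, mul_sum]
    rw [sum_comm]
    refine sum_congr rfl fun a _ => ?_
    have h := sum_bernoulliWeight_superset p (T a)
    calc _ = w a * f a * ∑ Z, bernoulliWeight p Z * (if T a ⊆ Z then 1 else 0) := by
          rw [mul_sum]; exact sum_congr rfl fun Z _ => by split_ifs <;> ring
      _ = f a := by rw [h, hw]; field_simp
  have mean2 (f : ι → ι → ℝ) : ∑ Z, bernoulliWeight p Z * ∑ a ∈ Ω with T a ⊆ Z,
        ∑ b ∈ Ω with T b ⊆ Z, w a * w b * f a b =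
      ∑ a ∈ Ω, ∑ b ∈ Ω, (p ^ #(T a ∩ T b))⁻¹ * f a b := by
    have e (Z : Finset α) : bernoulliWeight p Z * ∑ a ∈ Ω with T a ⊆ Z,
        ∑ b ∈ Ω with T b ⊆ Z, w a * w b * f a b = ∑ a ∈ Ω, ∑ b ∈ Ω, w a * w b * f a b *
          (bernoulliWeight p Z * if T a ∪ T b ⊆ Z then 1 else 0) := by
      simp only [sum_filter, mul_sum, union_subset_iff]
      refine sum_congr rfl fun a _ => ?_
      by_cases ha : T a ⊆ Z
      · simp only [ha, if_true, true_and, mul_sum]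
        exact sum_congr rfl fun b _ => by split_ifs <;> ring
      · simp [ha]
    simp only [e]
    rw [sum_comm]
    refine sum_congr rfl fun a _ => ?_
    rw [sum_comm]
    refine sum_congr rfl fun b _ => ?_
    rw [← mul_sum, sum_bernoulliWeight_superset]
    have hcard := card_union_add_card_inter (T a) (T b)
    have hpow : p ^ #(T a ∪ T b) * p ^ #(T a ∩ T b) = p ^ #(T a) * p ^ #(T b) := by
      rw [← pow_add, ← pow_add, hcard]
    simp only [hw]
    field_simp
    linear_combination f a b * hpow
  have hcap : ∑ a ∈ Ω, ∑ b ∈ Ω, (p ^ #(T a ∩ T b))⁻¹ *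
      ((r * p) ^ #(T a ∩ T b) / 2 ^ #(T a)) ≤ m * m := by
    have hin (a : ι) : ∑ b ∈ Ω, (p ^ #(T a ∩ T b))⁻¹ *
        ((r * p) ^ #(T a ∩ T b) / 2 ^ #(T a)) ≤ m := by
      have e (b : ι) : (p ^ #(T a ∩ T b))⁻¹ * ((r * p) ^ #(T a ∩ T b) / 2 ^ #(T a)) =
          r ^ #(T a ∩ T b) / 2 ^ #(T a) := by rw [mul_pow]; field_simp
      simp only [e, ← sum_div]
      rw [div_le_iff₀ (by positivity)]
      calc ∑ b ∈ Ω, r ^ #(T a ∩ T b)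
          ≤ ∑ b ∈ Ω, ∑ X ∈ (T a).powerset, if X ⊆ T b then r ^ #X else 0 := by
            refine sum_le_sum fun b _ => ?_
            have := single_le_sum (s := (T a).powerset)
              (f := fun X => if X ⊆ T b then r ^ #X else 0)
              (fun X _ => by split_ifs <;> positivity)
              (mem_powerset.mpr (inter_subset_left (s₂ := T b)))
            simpa using this
        _ = ∑ X ∈ (T a).powerset, r ^ #X * #{b ∈ Ω | X ⊆ T b} := by
            rw [sum_comm]
            refine sum_congr rfl fun X _ => ?_
            rw [← sum_filter, sum_const, nsmul_eq_mul, mul_comm]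
        _ ≤ ∑ X ∈ (T a).powerset, m := sum_le_sum fun X _ => hspread X
        _ = m * 2 ^ #(T a) := by rw [sum_const, card_powerset, nsmul_eq_mul]; push_cast; ring
    calc _ ≤ ∑ a ∈ Ω, m := sum_le_sum fun a _ => hin a
      _ = m * m := by rw [sum_const, nsmul_eq_mul]
  have hA := mean fun a => #(T a)
  have hB := mean2 fun a b => (r * p) ^ #(T a ∩ T b) / 2 ^ #(T a)
  have hC := mean fun _ => 1
  have hD := sum_bernoulliWeight (α := α) p
  simp only [mul_one, sum_const, nsmul_eq_mul] at hC
  have e (Z : Finset α) : bernoulliWeight p Z * (Real.log 2 * ∑ a ∈ Ω with T a ⊆ Z, w a * #(T a) +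
      m⁻¹ * (∑ a ∈ Ω with T a ⊆ Z, ∑ b ∈ Ω with T b ⊆ Z,
        w a * w b * ((r * p) ^ #(T a ∩ T b) / 2 ^ #(T a))) + m -
      2 * ∑ a ∈ Ω with T a ⊆ Z, w a) =
      Real.log 2 * (bernoulliWeight p Z * ∑ a ∈ Ω with T a ⊆ Z, w a * #(T a)) +
      m⁻¹ * (bernoulliWeight p Z * ∑ a ∈ Ω with T a ⊆ Z, ∑ b ∈ Ω with T b ⊆ Z,
        w a * w b * ((r * p) ^ #(T a ∩ T b) / 2 ^ #(T a))) + m * bernoulliWeight p Z -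
      2 * (bernoulliWeight p Z * ∑ a ∈ Ω with T a ⊆ Z, w a) := by ring
  simp only [e, sum_sub_distrib, sum_add_distrib, ← mul_sum _ _ (Real.log 2),
    ← mul_sum _ _ m, ← mul_sum _ _ m⁻¹, ← mul_sum _ _ (2 : ℝ), hA, hB, hC, hD] at hmain
  have hcap' := mul_le_mul_of_nonneg_left hcap (inv_pos.mpr hm).le
  rw [← mul_assoc, inv_mul_cancel₀ hm.ne', one_mul] at hcap'
  have hL : Real.log (r * p) * ∑ Z, bernoulliWeight p Z *
        ((∑ a ∈ Ω with T a ⊆ Z, ∑ b ∈ Ω with T b ⊆ Z, w a * w b * #(T a ∩ T b)) /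
            ∑ b ∈ Ω with T b ⊆ Z, w b) =
      ∑ Z, bernoulliWeight p Z * (Real.log (r * p) *
        ((∑ a ∈ Ω with T a ⊆ Z, ∑ b ∈ Ω with T b ⊆ Z, w a * w b * #(T a ∩ T b)) /
            ∑ b ∈ Ω with T b ⊆ Z, w b)) := by
    rw [mul_sum]; exact sum_congr rfl fun Z _ => by ring
  rw [hL]
  linarith

/-- Shrinking the members of a spread family, given a random set, to fragments that together with
the random set still cover a member. -/
theorem exists_fragment {ι : Type*} {Ω : Finset ι} (hΩ : Ω.Nonempty) (T : ι → Finset α)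
    {r p : ℝ} (hr : 0 < r) (hp0 : 0 < p) (hp1 : p ≤ 1) (hrp : 1 ≤ r * p)
    (hspread : ∀ X, r ^ #X * #{a ∈ Ω | X ⊆ T a} ≤ #Ω) :
    ∃ T' : Finset α → ι → Finset α, (∀ V, ∀ a ∈ Ω, T' V a ⊆ T a) ∧
      (∀ V, ∀ a ∈ Ω, ∃ b ∈ Ω, T b ⊆ V ∪ T' V a) ∧
      Real.log (r * p) * ∑ V, bernoulliWeight p V * ∑ a ∈ Ω, (#(T' V a) : ℝ) ≤
        Real.log 2 * ∑ a ∈ Ω, (#(T a) : ℝ) := by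
  have hmin (Z : Finset α) (a : ι) : ∃ b, a ∈ Ω → T a ⊆ Z → (b ∈ Ω ∧ T b ⊆ Z) ∧
      ∀ b' ∈ Ω, T b' ⊆ Z → #(T a ∩ T b) ≤ #(T a ∩ T b') := by
    by_cases h : a ∈ Ω ∧ T a ⊆ Z
    · obtain ⟨b, hb, hb'⟩ := exists_min_image (Ω.filter fun b => T b ⊆ Z)
        (fun b => #(T a ∩ T b)) ⟨a, mem_filter.mpr h⟩
      exact ⟨b, fun _ _ => ⟨mem_filter.mp hb, fun b' h1 h2 => hb' b' (mem_filter.mpr ⟨h1, h2⟩)⟩⟩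
    · exact ⟨a, fun h1 h2 => absurd ⟨h1, h2⟩ h⟩
  choose f hf using hmin
  refine ⟨fun V a => T a ∩ T (f (V ∪ T a) a), fun V a _ => inter_subset_left, fun V a ha => ?_, ?_⟩
  · obtain ⟨⟨h1, h2⟩, -⟩ := hf (V ∪ T a) a ha subset_union_right
    refine ⟨_, h1, fun x hx => ?_⟩
    have := h2 hx
    simp only [mem_union, mem_inter] at this ⊢
    tauto
  · refine le_trans (mul_le_mul_of_nonneg_left ?_ (Real.log_nonneg hrp))
      (sum_overlap_le hΩ T hr hp0 hp1 hspread)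
    have h1 : ∑ V, bernoulliWeight p V * ∑ a ∈ Ω, (#(T a ∩ T (f (V ∪ T a) a)) : ℝ) =
        ∑ Z, bernoulliWeight p Z * ∑ a ∈ Ω with T a ⊆ Z,
          (p ^ #(T a))⁻¹ * (#(T a ∩ T (f Z a)) : ℝ) := by
      simp only [sum_filter, mul_sum]
      rw [sum_comm, sum_comm (s := univ (α := Finset α))]
      refine sum_congr rfl fun a _ => ?_
      have h := sum_bernoulliWeight_union p (T a) fun Z =>
        (p ^ #(T a))⁻¹ * (#(T a ∩ T (f Z a)) : ℝ)
      have hpa : p ^ #(T a) ≠ 0 := by positivity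
      rw [← h, mul_sum]
      refine sum_congr rfl fun V _ => ?_
      rw [mul_left_comm, mul_inv_cancel_left₀ hpa]
    rw [h1]
    refine sum_le_sum fun Z _ => mul_le_mul_of_nonneg_left ?_
      (bernoulliWeight_nonneg hp0.le hp1 Z)
    rw [sum_div]
    refine sum_le_sum fun a ha => ?_
    obtain ⟨haΩ, haZ⟩ := mem_filter.mp ha
    have hN : 0 < ∑ b ∈ Ω with T b ⊆ Z, (p ^ #(T b))⁻¹ :=
      sum_pos (fun b _ => by positivity) ⟨a, ha⟩
    rw [le_div_iff₀ hN, mul_sum]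
    refine sum_le_sum fun b hb => ?_
    obtain ⟨hbΩ, hbZ⟩ := mem_filter.mp hb
    have hle : (#(T a ∩ T (f Z a)) : ℝ) ≤ #(T a ∩ T b) := by
      exact_mod_cast (hf Z a haΩ haZ).2 b hbΩ hbZ
    rw [mul_right_comm]
    gcongr

open Classical in
/-- The spread lemma: a random set contains a member of a spread family with high probability. -/
theorem spread_lemma {ι : Type*} {Ω : Finset ι} (hΩ : Ω.Nonempty) (T : ι → Finset α)
    {r p : ℝ} (hr : 0 < r) (hp0 : 0 < p) (hp1 : p ≤ 1) (hrp : 8 ≤ r * p)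
    (hspread : ∀ X, r ^ #X * #{a ∈ Ω | X ⊆ T a} ≤ #Ω) (β : ℕ) :
    3 ^ β * (#Ω * ∑ W, bernoulliWeight (1 - (1 - p) ^ β) W *
      if ∃ a ∈ Ω, T a ⊆ W then 0 else 1) ≤ ∑ a ∈ Ω, (#(T a) : ℝ) := by
  induction β generalizing T with
  | zero =>
    have h0 : ∑ W : Finset α, bernoulliWeight 0 W *
        (if ∃ a ∈ Ω, T a ⊆ W then (0 : ℝ) else 1) = if ∃ a ∈ Ω, T a = ∅ then 0 else 1 := by
      rw [sum_eq_single ∅]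
      · simp [bernoulliWeight]
      · intro W _ hW
        rw [bernoulliWeight, zero_pow (card_ne_zero.mpr (nonempty_iff_ne_empty.mpr hW))]
        simp
      · simp
    simp only [pow_zero, sub_self, one_mul, h0]
    split_ifs with h1
    · simp only [mul_zero]
      exact sum_nonneg fun _ _ => Nat.cast_nonneg _
    · push Not at h1
      rw [← nsmul_eq_mul]
      refine card_nsmul_le_sum _ _ _ fun a ha => ?_
      exact_mod_cast card_pos.mpr (h1 a ha)
  | succ β ih =>
    obtain ⟨T', hT', hcov, hmean⟩ := exists_fragment hΩ T hr hp0 hp1 (by linarith) hspread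
    have hlog : 3 * Real.log 2 ≤ Real.log (r * p) := by
      rw [show 3 * Real.log 2 = Real.log 8 by
        rw [show (8 : ℝ) = 2 ^ 3 by norm_num, Real.log_pow]; norm_num]
      exact Real.log_le_log (by norm_num) hrp
    have hq0 : 0 ≤ 1 - (1 - p) ^ β := by
      linarith [pow_le_one₀ (n := β) (sub_nonneg.mpr hp1) (by linarith : 1 - p ≤ 1)]
    have hq1 : 1 - (1 - p) ^ β ≤ 1 := by
      linarith [pow_nonneg (sub_nonneg.mpr hp1) β]
    have hstep (V : Finset α) : 3 ^ β * (#Ω * ∑ W, bernoulliWeight (1 - (1 - p) ^ β) W *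
        if ∃ a ∈ Ω, T a ⊆ V ∪ W then 0 else 1) ≤ ∑ a ∈ Ω, (#(T' V a) : ℝ) := by
      refine le_trans ?_ (ih (T' V) fun X => le_trans ?_ (hspread X))
      · gcongr with W
        · exact bernoulliWeight_nonneg hq0 hq1 W
        · split_ifs with h1 h2 h2 <;> norm_num
          obtain ⟨a, ha, haW⟩ := h2
          obtain ⟨b, hb, hbV⟩ := hcov V a ha
          exact h1 ⟨b, hb, hbV.trans (union_subset_union_right haW)⟩
      · refine mul_le_mul_of_nonneg_left (Nat.cast_le.mpr (card_le_card fun a ha => ?_))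
          (by positivity)
        obtain ⟨h1, h2⟩ := mem_filter.mp ha
        exact mem_filter.mpr ⟨h1, h2.trans (hT' V a h1)⟩
    have hunion := sum_sum_bernoulliWeight_union hp0.ne' (1 - (1 - p) ^ β)
      fun W => if ∃ a ∈ Ω, T a ⊆ W then (0 : ℝ) else 1
    rw [show 1 - (1 - p) ^ (β + 1) = 1 - (1 - (1 - (1 - p) ^ β)) * (1 - p) by ring, ← hunion]
    have hsum := sum_le_sum fun V (_ : V ∈ (univ : Finset (Finset α))) =>
      mul_le_mul_of_nonneg_left (hstep V) (bernoulliWeight_nonneg hp0.le hp1 V)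
    have hswap : ∑ W, bernoulliWeight (1 - (1 - p) ^ β) W * ∑ V, bernoulliWeight p V *
          (if ∃ a ∈ Ω, T a ⊆ V ∪ W then (0 : ℝ) else 1) =
        ∑ V, bernoulliWeight p V * ∑ W, bernoulliWeight (1 - (1 - p) ^ β) W *
          (if ∃ a ∈ Ω, T a ⊆ V ∪ W then (0 : ℝ) else 1) := by
      simp only [mul_sum]
      rw [sum_comm]
      exact sum_congr rfl fun _ _ => sum_congr rfl fun _ _ => by ring
    have hpull : ∑ V, bernoulliWeight p V * (3 ^ β * (#Ω * ∑ W,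
          bernoulliWeight (1 - (1 - p) ^ β) W *
            (if ∃ a ∈ Ω, T a ⊆ V ∪ W then (0 : ℝ) else 1))) =
        3 ^ β * (#Ω * ∑ V, bernoulliWeight p V * ∑ W, bernoulliWeight (1 - (1 - p) ^ β) W *
          (if ∃ a ∈ Ω, T a ⊆ V ∪ W then (0 : ℝ) else 1)) := by
      rw [mul_sum _ _ (#Ω : ℝ), mul_sum _ _ ((3 : ℝ) ^ β)]
      exact sum_congr rfl fun _ _ => by ring
    rw [hpull, ← hswap] at hsum
    have hE : 0 ≤ ∑ V, bernoulliWeight p V * ∑ a ∈ Ω, (#(T' V a) : ℝ) :=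
      sum_nonneg fun V _ => mul_nonneg (bernoulliWeight_nonneg hp0.le hp1 V)
        (sum_nonneg fun _ _ => Nat.cast_nonneg _)
    have h3 := (mul_le_mul_of_nonneg_right hlog hE).trans hmean
    have h2 : 0 < Real.log 2 := Real.log_pos (by norm_num)
    rw [mul_comm (3 : ℝ), mul_assoc] at h3
    have h4 := le_of_mul_le_mul_left h3 h2
    rw [pow_succ]
    linarith

end

/-- No choice of one member from each family is pairwise disjoint. -/
def CrossDependent {s : ℕ} {γ : Type*} (S : Fin s → Finset (Finset γ)) : Prop :=
  ¬ ∃ B : Fin s → Finset γ, (∀ i, B i ∈ S i) ∧ ∀ i i', i ≠ i' → Disjoint (B i) (B i')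

section
variable {s : ℕ} {γ : Type*} [DecidableEq γ]

theorem card_biUnion_erase_le {B : Fin s → Finset γ} (hB : ∀ i, #(B i) ≤ 2) (i : Fin s) :
    #((univ.erase i).biUnion B) ≤ 2 * (s - 1) := by
  refine (card_biUnion_le_card_mul _ _ 2 fun j _ => hB j).trans_eq ?_
  rw [card_erase_of_mem (mem_univ i), card_univ, Fintype.card_fin, mul_comm]

theorem CrossDependent.not_disjoint_biUnion {S : Fin s → Finset (Finset γ)}
    (hS : CrossDependent S) {B : Fin s → Finset γ} {i : Fin s} (hB : ∀ j, j ≠ i → B j ∈ S j)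
    (hdisj : ∀ j j', j ≠ j' → Disjoint (B j) (B j')) {P : Finset γ} (hP : P ∈ S i) :
    ¬ Disjoint P ((univ.erase i).biUnion B) := by
  intro h
  rw [disjoint_biUnion_right] at h
  refine hS ⟨Function.update B i P, fun j => ?_, fun j j' hj => ?_⟩
  · by_cases hj : j = i
    · subst hj; simpa using hP
    · simpa [hj] using hB j hj
  · by_cases h1 : j = i
    · subst h1
      simpa [hj.symm] using h j' (by simpa using hj.symm)
    · by_cases h2 : j' = i
      · subst h2
        simpa [h1] using (h j (by simpa using h1)).symm
      · simpa [h1, h2] using hdisj j j' hj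

/-- A family with too many pairs in a cross-dependent system can be coarsened so that the number of
pairs drops. -/
theorem CrossDependent.exists_coarsening {S : Fin s → Finset (Finset γ)}
    (hS : CrossDependent S) (hcard : ∀ i, ∀ B ∈ S i, #B ≤ 2) {i : Fin s}
    (hi : 4 * (s - 1) ^ 2 < #{B ∈ S i | #B = 2}) :
    ∃ N : Finset (Finset γ), (∀ B ∈ N, #B ≤ 2) ∧ (∀ B ∈ S i, ∃ B' ∈ N, B' ⊆ B) ∧
      #{B ∈ N | #B = 2} < #{B ∈ S i | #B = 2} ∧ CrossDependent (Function.update S i N) := by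
  have hunpack {N : Finset (Finset γ)} (hN2 : ∀ B ∈ N, #B ≤ 2) {B : Fin s → Finset γ}
      (hB : ∀ j, B j ∈ Function.update S i N j) :
      B i ∈ N ∧ (∀ j, j ≠ i → B j ∈ S j) ∧ ∀ j, #(B j) ≤ 2 := by
    have h1 : B i ∈ N := by simpa using hB i
    have h2 (j) (hj : j ≠ i) : B j ∈ S j := by simpa [hj] using hB j
    refine ⟨h1, h2, fun j => ?_⟩
    by_cases hj : j = i
    · subst hj; exact hN2 _ h1
    · exact hcard j _ (h2 j hj)
  by_cases hdeg : ∃ x, 2 * (s - 1) < #{B ∈ S i | #B = 2 ∧ x ∈ B}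
  · obtain ⟨x, hx⟩ := hdeg
    have hN2 : ∀ B ∈ insert {x} {B ∈ S i | ¬ (#B = 2 ∧ x ∈ B)}, #B ≤ 2 := by
      intro B hB
      rcases mem_insert.mp hB with rfl | hB
      · simp
      · exact hcard i B (mem_filter.mp hB).1
    refine ⟨insert {x} {B ∈ S i | ¬ (#B = 2 ∧ x ∈ B)}, hN2, fun B hB => ?_, ?_, ?_⟩
    · by_cases h : #B = 2 ∧ x ∈ B
      · exact ⟨{x}, mem_insert_self _ _, singleton_subset_iff.mpr h.2⟩
      · exact ⟨B, mem_insert_of_mem (mem_filter.mpr ⟨hB, h⟩), Subset.rfl⟩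
    · refine card_lt_card ((ssubset_iff_of_subset fun B hB => ?_).mpr ?_)
      · obtain ⟨h1, h2⟩ := mem_filter.mp hB
        rcases mem_insert.mp h1 with rfl | h1
        · simp at h2
        · exact mem_filter.mpr ⟨(mem_filter.mp h1).1, h2⟩
      · obtain ⟨B, hB⟩ := card_pos.mp (Nat.zero_lt_of_lt hx)
        obtain ⟨h1, h2, h3⟩ := mem_filter.mp hB
        refine ⟨B, mem_filter.mpr ⟨h1, h2⟩, fun h => ?_⟩
        rcases mem_insert.mp (mem_filter.mp h).1 with rfl | h4
        · simp at h2
        · exact (mem_filter.mp h4).2 ⟨h2, h3⟩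
    · rintro ⟨B, hB, hdisj⟩
      obtain ⟨hBi, hBj, hB2⟩ := hunpack hN2 hB
      rcases mem_insert.mp hBi with hBx | hBi
      · have hxC : x ∉ (univ.erase i).biUnion B := by
          simp only [mem_biUnion, mem_erase, not_exists, not_and]
          intro j hj hxj
          refine disjoint_left.mp (hdisj i j hj.1.symm) ?_ hxj
          simp [hBx]
        have hsub : {P ∈ S i | #P = 2 ∧ x ∈ P} ⊆
            ((univ.erase i).biUnion B).image fun y => {x, y} := by
          intro P hP
          obtain ⟨hPS, hP2, hxP⟩ := mem_filter.mp hP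
          obtain ⟨y, hyP, hyC⟩ := not_disjoint_iff.mp (hS.not_disjoint_biUnion hBj hdisj hPS)
          refine mem_image.mpr ⟨y, hyC, eq_of_subset_of_card_le ?_ ?_⟩
          · simp [insert_subset_iff, hxP, hyP]
          · rw [hP2, card_pair (by rintro rfl; exact hxC hyC)]
        have := card_le_card hsub
        have := card_image_le (s := (univ.erase i).biUnion B) (f := fun y => ({x, y} : Finset γ))
        have := card_biUnion_erase_le hB2 i
        omega
      · refine hS ⟨B, fun j => ?_, hdisj⟩
        by_cases hj : j = i
        · subst hj; exact (mem_filter.mp hBi).1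
        · exact hBj j hj
  · push Not at hdeg
    have hN2 : ∀ B ∈ ({∅} : Finset (Finset γ)), #B ≤ 2 := by simp
    refine ⟨{∅}, hN2, fun B _ => ⟨∅, by simp⟩, ?_, ?_⟩
    · refine lt_of_le_of_lt (le_of_eq ?_) (Nat.zero_lt_of_lt hi)
      simp [filter_singleton]
    · rintro ⟨B, hB, hdisj⟩
      obtain ⟨-, hBj, hB2⟩ := hunpack hN2 hB
      have hsub : {P ∈ S i | #P = 2} ⊆
          ((univ.erase i).biUnion B).biUnion fun y => {P ∈ S i | #P = 2 ∧ y ∈ P} := by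
        intro P hP
        obtain ⟨hPS, hP2⟩ := mem_filter.mp hP
        obtain ⟨y, hyP, hyC⟩ := not_disjoint_iff.mp (hS.not_disjoint_biUnion hBj hdisj hPS)
        exact mem_biUnion.mpr ⟨y, hyC, mem_filter.mpr ⟨hPS, hP2, hyP⟩⟩
      have h1 := card_le_card hsub
      have h2 := card_biUnion_le_card_mul ((univ.erase i).biUnion B)
        (fun y => {P ∈ S i | #P = 2 ∧ y ∈ P}) _ fun y _ => hdeg y
      have h3 := Nat.mul_le_mul_right (2 * (s - 1)) (card_biUnion_erase_le hB2 i)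
      have h4 : 2 * (s - 1) * (2 * (s - 1)) = 4 * (s - 1) ^ 2 := by ring
      omega

theorem CrossDependent.exists_few_pairs (S : Fin s → Finset (Finset γ))
    (hS : CrossDependent S) (hcard : ∀ i, ∀ B ∈ S i, #B ≤ 2) :
    ∃ S' : Fin s → Finset (Finset γ), CrossDependent S' ∧ (∀ i, ∀ B ∈ S' i, #B ≤ 2) ∧
      (∀ i, ∀ B ∈ S i, ∃ B' ∈ S' i, B' ⊆ B) ∧
      ∀ i, #{B ∈ S' i | #B = 2} ≤ 4 * (s - 1) ^ 2 := by
  induction hn : ∑ i, #{B ∈ S i | #B = 2} using Nat.strong_induction_on generalizing S with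
  | _ m ih =>
    by_cases hsmall : ∀ i, #{B ∈ S i | #B = 2} ≤ 4 * (s - 1) ^ 2
    · exact ⟨S, hS, hcard, fun i B hB => ⟨B, hB, Subset.rfl⟩, hsmall⟩
    push Not at hsmall
    obtain ⟨i, hi⟩ := hsmall
    obtain ⟨N, hN2, hcov, hlt, hdep⟩ := hS.exists_coarsening hcard hi
    obtain ⟨S', h1, h2, h3, h4⟩ := ih _ (by
      rw [← hn]
      refine sum_lt_sum (fun j _ => ?_) ⟨i, mem_univ i, by simpa using hlt⟩
      by_cases hj : j = i
      · subst hj; simpa using hlt.le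
      · simp [hj]) (Function.update S i N) hdep (fun j => by
        by_cases hj : j = i
        · subst hj; simpa using hN2
        · simpa [hj] using hcard j) rfl
    refine ⟨S', h1, h2, fun j B hB => ?_, h4⟩
    by_cases hj : j = i
    · subst hj
      obtain ⟨B', hB', hsub⟩ := hcov B hB
      obtain ⟨B'', hB'', hsub'⟩ := h3 j B' (by simpa using hB')
      exact ⟨B'', hB'', hsub'.trans hsub⟩
    · exact h3 j B (by simpa [hj] using hB)
end

section
variable {k n : ℕ}

/-- The subset of the ground set associated with a tuple. -/
def tupleSet (x : Fin k → Fin n) : Finset (Fin k × Fin n) :=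
  univ.image fun j => (j, x j)

theorem mem_tupleSet {x : Fin k → Fin n} {y : Fin k × Fin n} : y ∈ tupleSet x ↔ x y.1 = y.2 := by
  obtain ⟨j, v⟩ := y
  simp [tupleSet]

theorem card_tupleSet (x : Fin k → Fin n) : #(tupleSet x) = k := by
  rw [tupleSet, card_image_of_injective _ fun i j h => (Prod.mk.inj h).1, card_univ,
    Fintype.card_fin]

theorem card_filter_subset_tupleSet_le (F : Finset (Fin k → Fin n)) (X : Finset (Fin k × Fin n)) :
    #{x ∈ F | X ⊆ tupleSet x} ≤ n ^ (k - #X) := by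
  obtain h0 | ⟨x₀, hx₀⟩ := (F.filter fun x => X ⊆ tupleSet x).eq_empty_or_nonempty
  · simp [h0]
  have hX := (mem_filter.mp hx₀).2
  have hJ : #(X.image Prod.fst) = #X := card_image_of_injOn fun y hy z hz h => by
    have h1 := mem_tupleSet.mp (hX hy)
    have h2 := mem_tupleSet.mp (hX hz)
    exact Prod.ext h (by rw [← h1, ← h2, h])
  have hsub : {x ∈ F | X ⊆ tupleSet x} ⊆ Fintype.piFinset fun j =>
      if j ∈ X.image Prod.fst then {x₀ j} else univ := by
    intro x hx
    rw [Fintype.mem_piFinset]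
    intro j
    split_ifs with hj
    · obtain ⟨y, hy, rfl⟩ := mem_image.mp hj
      rw [mem_singleton, mem_tupleSet.mp ((mem_filter.mp hx).2 hy), mem_tupleSet.mp (hX hy)]
    · exact mem_univ _
  refine (card_le_card hsub).trans_eq ?_
  rw [Fintype.card_piFinset, ← prod_mul_prod_compl (X.image Prod.fst),
    prod_congr rfl (g := fun _ => 1) fun j hj => by rw [if_pos hj, card_singleton],
    prod_congr (s₁ := (X.image Prod.fst)ᶜ) rfl (g := fun _ => n) fun j hj => by
      rw [if_neg (mem_compl.mp hj), card_univ, Fintype.card_fin],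
    prod_const_one, prod_const, one_mul, card_compl, hJ, Fintype.card_fin]

/-- `G` consists of tuples through `B`, and its link at `B` is `R`-spread. -/
structure IsSpreadAt (R : ℝ) (B : Finset (Fin k × Fin n)) (G : Finset (Fin k → Fin n)) :
    Prop where
  nonempty : G.Nonempty
  subset : ∀ x ∈ G, B ⊆ tupleSet x
  spread : ∀ X, B ⊆ X → R ^ #X * #{x ∈ G | X ⊆ tupleSet x} ≤ R ^ #B * #G

theorem exists_isSpreadAt {R : ℝ} (hR : 0 < R) {F : Finset (Fin k → Fin n)} (hF : F.Nonempty) :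
    ∃ X : Finset (Fin k × Fin n), IsSpreadAt R X {x ∈ F | X ⊆ tupleSet x} ∧
      (#F : ℝ) ≤ R ^ #X * #{x ∈ F | X ⊆ tupleSet x} := by
  obtain ⟨X, -, hX⟩ := exists_max_image (univ : Finset (Finset (Fin k × Fin n)))
    (fun X => R ^ #X * (#{x ∈ F | X ⊆ tupleSet x} : ℝ)) univ_nonempty
  have hle : (#F : ℝ) ≤ R ^ #X * #{x ∈ F | X ⊆ tupleSet x} := by
    simpa using hX ∅ (mem_univ _)
  refine ⟨X, ⟨?_, fun x hx => (mem_filter.mp hx).2, fun Y hY => ?_⟩, hle⟩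
  · rw [nonempty_iff_ne_empty]
    intro h
    rw [h, card_empty, Nat.cast_zero, mul_zero] at hle
    have : (0 : ℝ) < #F := by exact_mod_cast hF.card_pos
    linarith
  · refine le_trans (mul_le_mul_of_nonneg_left (Nat.cast_le.mpr (card_le_card ?_))
      (by positivity)) (hX Y (mem_univ _))
    exact filter_subset_filter _ (filter_subset _ _)

/-- Every family splits into spread pieces at sets of size at most two and a small remainder. -/
theorem exists_spread_approximation {R : ℝ} (hR : 0 < R) (hRn : R ≤ n)
    (F : Finset (Fin k → Fin n)) :
    ∃ (S : Finset (Finset (Fin k × Fin n))) (F' : Finset (Fin k → Fin n)), F' ⊆ F ∧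
      (∀ B ∈ S, #B ≤ 2 ∧ ∃ G ⊆ F, IsSpreadAt R B G) ∧
      (∀ x ∈ F, (∃ B ∈ S, B ⊆ tupleSet x) ∨ x ∈ F') ∧
      (#F' : ℝ) ≤ R ^ 3 * (n : ℝ) ^ (k - 3) := by
  induction F using Finset.strongInduction with
  | H F ih =>
    obtain rfl | hF := F.eq_empty_or_nonempty
    · exact ⟨∅, ∅, Subset.rfl, by simp, by simp, by simp; positivity⟩
    obtain ⟨X, hX, hle⟩ := exists_isSpreadAt hR hF
    by_cases hcard : #X ≤ 2
    · have hssub : {x ∈ F | ¬ X ⊆ tupleSet x} ⊂ F := by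
        obtain ⟨x, hx⟩ := hX.nonempty
        obtain ⟨hxF, hxX⟩ := mem_filter.mp hx
        exact filter_ssubset.mpr ⟨x, hxF, not_not.mpr hxX⟩
      obtain ⟨S, F', h1, h2, h3, h4⟩ := ih _ hssub
      refine ⟨insert X S, F', h1.trans hssub.subset, fun B hB => ?_, fun x hx => ?_, h4⟩
      · rcases mem_insert.mp hB with rfl | hB
        · exact ⟨hcard, _, filter_subset _ _, hX⟩
        · obtain ⟨h5, G, hG, h6⟩ := h2 B hB
          exact ⟨h5, G, hG.trans hssub.subset, h6⟩
      · by_cases hxX : X ⊆ tupleSet x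
        · exact Or.inl ⟨X, mem_insert_self _ _, hxX⟩
        · refine (h3 x (mem_filter.mpr ⟨hx, hxX⟩)).imp_left ?_
          rintro ⟨B, hB, hBx⟩
          exact ⟨B, mem_insert_of_mem hB, hBx⟩
    · refine ⟨∅, F, Subset.rfl, by simp, fun x hx => Or.inr hx, hle.trans ?_⟩
      have hXk : #X ≤ k := by
        obtain ⟨x, hx⟩ := hX.nonempty
        exact (card_le_card (hX.subset x hx)).trans_eq (card_tupleSet x)
      have hlink : (#{x ∈ F | X ⊆ tupleSet x} : ℝ) ≤ (n : ℝ) ^ (k - #X) := by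
        exact_mod_cast card_filter_subset_tupleSet_le F X
      obtain ⟨d, hd⟩ : ∃ d, #X = 3 + d := ⟨#X - 3, by omega⟩
      calc R ^ #X * (#{x ∈ F | X ⊆ tupleSet x} : ℝ)
          ≤ R ^ #X * (n : ℝ) ^ (k - #X) := by gcongr
        _ = R ^ 3 * (R ^ d * (n : ℝ) ^ (k - #X)) := by rw [hd, pow_add]; ring
        _ ≤ R ^ 3 * ((n : ℝ) ^ d * (n : ℝ) ^ (k - #X)) := by gcongr
        _ = R ^ 3 * (n : ℝ) ^ (k - 3) := by rw [← pow_add]; congr 2; omega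

/-- Deleting the members that meet a small set keeps a link spread, up to a factor two. -/
theorem IsSpreadAt.avoid {R : ℝ} {B : Finset (Fin k × Fin n)} {G : Finset (Fin k → Fin n)}
    (h : IsSpreadAt R B G) {C : Finset (Fin k × Fin n)} (hBC : Disjoint B C) (hR : 0 < R)
    (hC : 2 * (#C : ℝ) ≤ R) :
    ({x ∈ G | Disjoint (tupleSet x) C} : Finset _).Nonempty ∧
      ∀ X, (R / 2) ^ #X *
        #{x ∈ {x ∈ G | Disjoint (tupleSet x) C} | X ⊆ tupleSet x \ B} ≤
          (#{x ∈ G | Disjoint (tupleSet x) C} : ℝ) := by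
  have hG : (0 : ℝ) < #G := by exact_mod_cast h.nonempty.card_pos
  have hlink (X : Finset (Fin k × Fin n)) (hX : Disjoint X B) :
      R ^ #X * #{x ∈ G | X ⊆ tupleSet x} ≤ #G := by
    have h1 := h.spread (B ∪ X) subset_union_left
    rw [card_union_of_disjoint hX.symm, pow_add, mul_assoc] at h1
    refine le_trans (mul_le_mul_of_nonneg_left (Nat.cast_le.mpr (card_le_card fun x hx => ?_))
      (by positivity)) (le_of_mul_le_mul_left h1 (by positivity))
    obtain ⟨h2, h3⟩ := mem_filter.mp hx
    exact mem_filter.mpr ⟨h2, union_subset (h.subset x h2) h3⟩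
  have hbad : R * #{x ∈ G | ¬ Disjoint (tupleSet x) C} ≤ #C * #G := by
    have hsub : {x ∈ G | ¬ Disjoint (tupleSet x) C} ⊆
        C.biUnion fun y => {x ∈ G | {y} ⊆ tupleSet x} := by
      intro x hx
      obtain ⟨h1, h2⟩ := mem_filter.mp hx
      obtain ⟨y, hy, hyC⟩ := not_disjoint_iff.mp h2
      exact mem_biUnion.mpr ⟨y, hyC, mem_filter.mpr ⟨h1, singleton_subset_iff.mpr hy⟩⟩
    have hle : (#{x ∈ G | ¬ Disjoint (tupleSet x) C} : ℝ) ≤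
        ∑ y ∈ C, (#{x ∈ G | {y} ⊆ tupleSet x} : ℝ) := by
      exact_mod_cast (card_le_card hsub).trans card_biUnion_le
    calc R * (#{x ∈ G | ¬ Disjoint (tupleSet x) C} : ℝ)
        ≤ R * ∑ y ∈ C, (#{x ∈ G | {y} ⊆ tupleSet x} : ℝ) := by gcongr
      _ = ∑ y ∈ C, R * (#{x ∈ G | {y} ⊆ tupleSet x} : ℝ) := mul_sum _ _ _
      _ ≤ ∑ y ∈ C, (#G : ℝ) := sum_le_sum fun y hy => by
          simpa using hlink {y}
            (disjoint_singleton_left.mpr fun hyB => disjoint_left.mp hBC hyB hy)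
      _ = #C * #G := by rw [sum_const, nsmul_eq_mul]
  have hsplit : (#{x ∈ G | Disjoint (tupleSet x) C} : ℝ) +
      #{x ∈ G | ¬ Disjoint (tupleSet x) C} = #G := by
    exact_mod_cast card_filter_add_card_filter_not (s := G) fun x => Disjoint (tupleSet x) C
  have hhalf : (#G : ℝ) ≤ 2 * #{x ∈ G | Disjoint (tupleSet x) C} := by
    have h1 : R * (2 * #{x ∈ G | ¬ Disjoint (tupleSet x) C}) ≤ R * #G := by
      have := mul_le_mul_of_nonneg_right hC hG.le
      linarith
    have := le_of_mul_le_mul_left h1 hR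
    linarith
  refine ⟨card_pos.mp ?_, fun X => ?_⟩
  · have : (0 : ℝ) < #{x ∈ G | Disjoint (tupleSet x) C} := by linarith
    exact_mod_cast this
  obtain rfl | hXne := X.eq_empty_or_nonempty
  · simp
  by_cases hXB : Disjoint X B
  · have hsub : (#{x ∈ {x ∈ G | Disjoint (tupleSet x) C} | X ⊆ tupleSet x \ B} : ℝ) ≤
        #{x ∈ G | X ⊆ tupleSet x} := by
      refine Nat.cast_le.mpr (card_le_card fun x hx => ?_)
      obtain ⟨h1, h2⟩ := mem_filter.mp hx
      exact mem_filter.mpr ⟨(mem_filter.mp h1).1, h2.trans sdiff_subset⟩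
    have h2 : (2 : ℝ) ≤ 2 ^ #X := le_self_pow₀ (by norm_num) hXne.card_pos.ne'
    rw [div_pow, div_mul_eq_mul_div, div_le_iff₀ (by positivity)]
    calc _ ≤ R ^ #X * (#{x ∈ G | X ⊆ tupleSet x} : ℝ) := by gcongr
      _ ≤ #G := hlink X hXB
      _ ≤ (#{x ∈ G | Disjoint (tupleSet x) C} : ℝ) * 2 := by linarith
      _ ≤ _ := by gcongr
  · rw [filter_false_of_mem fun x _ hx =>
      hXB (disjoint_of_subset_left hx sdiff_disjoint)]
    simp
end

theorem exists_round_probability {s β : ℕ} (hs : 2 ≤ s) (hβ : β ≠ 0) :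
    ∃ p : ℝ, 0 < p ∧ p ≤ 1 ∧ 1 ≤ s * β * p ∧ 1 - (1 - p) ^ β = 1 / s := by
  have hs' : (2 : ℝ) ≤ s := by exact_mod_cast hs
  have hβ' : (1 : ℝ) ≤ β := by exact_mod_cast Nat.one_le_iff_ne_zero.mpr hβ
  have hb : (0 : ℝ) ≤ 1 - 1 / s := by
    rw [sub_nonneg, div_le_one (by linarith)]; linarith
  have hsβ : (1 : ℝ) ≤ s * β := by nlinarith
  set t : ℝ := (1 - 1 / s) ^ (β : ℝ)⁻¹ with ht
  have ht0 : 0 ≤ t := Real.rpow_nonneg hb _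
  have htβ : t ^ β = 1 - 1 / s := Real.rpow_inv_natCast_pow hb hβ
  have hle : t ≤ 1 - 1 / (s * β) := by
    have h0 : (0 : ℝ) ≤ 1 - 1 / (s * β) := by
      rw [sub_nonneg, div_le_one (by linarith)]; exact hsβ
    refine le_of_pow_le_pow_left₀ hβ h0 ?_
    have h := one_add_mul_le_pow (a := -(1 / (s * β) : ℝ)) (by linarith) β
    rw [htβ]
    refine le_trans (le_of_eq ?_) (h.trans_eq (by ring))
    field_simp
    ring
  have hpos : (0 : ℝ) < 1 / (s * β) := by positivity
  refine ⟨1 - t, by linarith, by linarith, ?_, by rw [sub_sub_cancel, htβ]; ring⟩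
  have h1 : 1 / (s * β : ℝ) ≤ 1 - t := by linarith
  rwa [div_le_iff₀ (by linarith), mul_comm] at h1

/-- Spread links at pairwise disjoint sets admit a rainbow matching. -/
theorem exists_rainbow_matching {s k n β : ℕ} (hs : 2 ≤ s) (hβ : β ≠ 0)
    (hβ2 : s * k ≤ 2 ^ β) {R : ℝ} (hR : 16 * (s * β) ≤ R)
    {B : Fin s → Finset (Fin k × Fin n)} {G : Fin s → Finset (Fin k → Fin n)}
    (hG : ∀ i, IsSpreadAt R (B i) (G i)) (hB : ∀ i, #(B i) ≤ 2)
    (hdisj : ∀ i i', i ≠ i' → Disjoint (B i) (B i')) :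
    ∃ g : Fin s → Fin k → Fin n, (∀ i, g i ∈ G i) ∧ ∀ i i', i ≠ i' → ∀ j, g i j ≠ g i' j := by
  classical
  have hs' : (2 : ℝ) ≤ s := by exact_mod_cast hs
  have hβ' : (1 : ℝ) ≤ β := by exact_mod_cast Nat.one_le_iff_ne_zero.mpr hβ
  have hRpos : 0 < R := by nlinarith
  obtain ⟨p, hp0, hp1, hp, hpβ⟩ := exists_round_probability hs hβ
  set C : Fin s → Finset (Fin k × Fin n) := fun i => (univ.erase i).biUnion B
  have hBC (i) : Disjoint (B i) (C i) := by
    rw [disjoint_biUnion_right]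
    exact fun j hj => hdisj i j (mem_erase.mp hj).1.symm
  have hC (i) : 2 * (#(C i) : ℝ) ≤ R := by
    have h : (#(C i) : ℝ) ≤ (2 * s : ℕ) :=
      Nat.cast_le.mpr ((card_biUnion_erase_le hB i).trans (by omega))
    push_cast at h
    nlinarith
  set G' : Fin s → Finset (Fin k → Fin n) := fun i => {x ∈ G i | Disjoint (tupleSet x) (C i)}
  have hG' (i) := (hG i).avoid (hBC i) hRpos (hC i)
  set bad : Fin s → Finset (Fin k × Fin n) → ℝ := fun i W =>
    if ∃ x ∈ G' i, tupleSet x \ B i ⊆ W then 0 else 1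
  have hfail (i) : 3 ^ β * ∑ W, bernoulliWeight (1 / s : ℝ) W * bad i W ≤ k := by
    have hne : (0 : ℝ) < #(G' i) := by exact_mod_cast (hG' i).1.card_pos
    have h := spread_lemma (hG' i).1 (fun x => tupleSet x \ B i) (half_pos hRpos) hp0 hp1
      (by nlinarith) (hG' i).2 β
    rw [hpβ] at h
    have hsum : ∑ x ∈ G' i, (#(tupleSet x \ B i) : ℝ) ≤ #(G' i) * k := by
      rw [← nsmul_eq_mul]
      refine sum_le_card_nsmul _ _ _ fun x _ => ?_
      exact_mod_cast (card_le_card sdiff_subset).trans_eq (card_tupleSet x)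
    refine le_of_mul_le_mul_left ?_ hne
    refine le_trans (le_of_eq ?_) (h.trans hsum)
    rw [mul_left_comm]
  have htotal : ∑ i, ∑ W, bernoulliWeight (1 / s : ℝ) W * bad i W < 1 := by
    have h1 : 3 ^ β * ∑ i, ∑ W, bernoulliWeight (1 / s : ℝ) W * bad i W ≤ s * k := by
      rw [mul_sum]
      refine (sum_le_card_nsmul _ _ _ fun i _ => hfail i).trans_eq ?_
      rw [card_univ, Fintype.card_fin, nsmul_eq_mul]
    have h2 : (s * k : ℝ) ≤ 2 ^ β := by exact_mod_cast hβ2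
    have h3 : (2 : ℝ) ^ β < 3 ^ β := pow_lt_pow_left₀ (by norm_num) (by norm_num) hβ
    refine lt_of_mul_lt_mul_left (a := (3 : ℝ) ^ β) ?_ (by positivity)
    linarith
  obtain ⟨c, hc⟩ : ∃ c : Fin k × Fin n → Fin s, ∀ i, bad i {y | c y = i} = 0 := by
    by_contra! hcon
    have hbad0 (i W) : 0 ≤ bad i W := by simp only [bad]; split_ifs <;> norm_num
    have h1 (c : Fin k × Fin n → Fin s) : 1 ≤ ∑ i, bad i {y | c y = i} := by
      obtain ⟨i, hi⟩ := hcon c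
      have hi1 : bad i {y | c y = i} = 1 := by
        simp only [bad] at hi ⊢
        split_ifs at hi ⊢ <;> simp_all
      rw [← hi1]
      exact single_le_sum (f := fun i => bad i {y | c y = i}) (fun i _ => hbad0 i _) (mem_univ i)
    have h2 := card_nsmul_le_sum univ _ _ fun c _ => h1 c
    rw [sum_comm] at h2
    simp only [sum_colorClass, ← mul_sum, card_univ, Fintype.card_fun, Fintype.card_fin,
      nsmul_eq_mul, Nat.cast_pow] at h2
    have hpow : (0 : ℝ) < (s : ℝ) ^ Fintype.card (Fin k × Fin n) := by positivity
    linarith [le_of_mul_le_mul_left h2 hpow]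
  have hgood (i) : ∃ x ∈ G' i, tupleSet x \ B i ⊆ ({y | c y = i} : Finset _) := by
    by_contra h
    exact one_ne_zero ((if_neg h).symm.trans (hc i))
  choose g hg hgc using hgood
  refine ⟨g, fun i => (mem_filter.mp (hg i)).1, fun i i' hne j heq => ?_⟩
  have hy : (j, g i j) ∈ tupleSet (g i) := mem_tupleSet.mpr rfl
  have hy' : (j, g i j) ∈ tupleSet (g i') := mem_tupleSet.mpr heq.symm
  have havoid {i i' : Fin s} (hne : i ≠ i') {y} (h : y ∈ tupleSet (g i)) : y ∉ B i' := fun hB =>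
    disjoint_left.mp (mem_filter.mp (hg i)).2 h
      (mem_biUnion.mpr ⟨i', mem_erase.mpr ⟨hne.symm, mem_univ _⟩, hB⟩)
  have h1 := hgc i (mem_sdiff.mpr ⟨hy, havoid hne.symm hy'⟩)
  have h2 := hgc i' (mem_sdiff.mpr ⟨hy', havoid hne hy⟩)
  simp only [mem_filter, mem_univ, true_and] at h1 h2
  exact hne (h1.symm.trans h2)

end


/-- Lemma 3.3 (spread approximation): if `F_1, …, F_s ⊆ [n]^k` are cross-dependent and
`n > r = 2^5 s log₂(sk)`, then there exist cross-dependent approximations `S_i` whose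
members have size at most 2, with remainders `F_i'` of size at most `r³n^{k-3}`, and
each `S_i` has at most `4(s-1)²` two-element members. -/
theorem stmt9 (s k n : ℕ) (hs : 2 ≤ s) (hk : 3 ≤ k)
    (hn : 2 ^ 5 * (s : ℝ) * Real.logb 2 ((s : ℝ) * (k : ℝ)) < (n : ℝ))
    (F : Fin s → Finset (Fin k → Fin n))
    (hdep : ¬ ∃ g : Fin s → (Fin k → Fin n), (∀ i, g i ∈ F i) ∧
      ∀ i i', i ≠ i' → ∀ j, g i j ≠ g i' j) :
    ∃ (S : Fin s → Finset (Finset (Fin k × Fin n))) (F' : Fin s → Finset (Fin k → Fin n)),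
      (∀ i, F' i ⊆ F i) ∧
      (∀ i, ∀ B ∈ S i, B.card ≤ 2) ∧
      (∀ i, ∀ x ∈ F i,
        (∃ B ∈ S i, B ⊆ Finset.univ.image (fun j : Fin k => (j, x j))) ∨ x ∈ F' i) ∧
      (∀ i, ((F' i).card : ℝ) ≤
        (2 ^ 5 * (s : ℝ) * Real.logb 2 ((s : ℝ) * (k : ℝ))) ^ 3 * (n : ℝ) ^ (k - 3)) ∧
      (¬ ∃ B : Fin s → Finset (Fin k × Fin n), (∀ i, B i ∈ S i) ∧
        ∀ i i', i ≠ i' → Disjoint (B i) (B i')) ∧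
      (∀ i, ((S i).filter (fun B => B.card = 2)).card ≤ 4 * (s - 1) ^ 2) := by
  have hs' : (2 : ℝ) ≤ s := by exact_mod_cast hs
  have hk' : (3 : ℝ) ≤ k := by exact_mod_cast hk
  have hsk : (2 : ℝ) ≤ s * k := by nlinarith
  set L := Real.logb 2 ((s : ℝ) * (k : ℝ)) with hLdef
  have hL1 : 1 ≤ L := by
    rw [hLdef, Real.le_logb_iff_rpow_le (by norm_num) (by linarith), Real.rpow_one]
    exact hsk
  have hR : 0 < 2 ^ 5 * (s : ℝ) * L := by positivity
  have hβ : ⌈L⌉₊ ≠ 0 := (Nat.ceil_pos.mpr (by linarith)).ne'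
  have hβL : (⌈L⌉₊ : ℝ) ≤ 2 * L := by linarith [Nat.ceil_lt_add_one (show 0 ≤ L by linarith)]
  have hβ2 : s * k ≤ 2 ^ ⌈L⌉₊ := by
    have h : (s * k : ℝ) ≤ 2 ^ ⌈L⌉₊ := by
      rw [← Real.rpow_natCast, ← Real.logb_le_iff_le_rpow (by norm_num) (by linarith)]
      exact Nat.le_ceil L
    exact_mod_cast h
  choose S F' hF' hS hcover hsize using fun i => exists_spread_approximation hR hn.le (F i)
  have hcross : CrossDependent S := by
    rintro ⟨B, hB, hdisj⟩
    choose G hGF hG using fun i => (hS i (B i) (hB i)).2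
    obtain ⟨g, hg, hgd⟩ := exists_rainbow_matching hs hβ hβ2 (by nlinarith) hG
      (fun i => (hS i (B i) (hB i)).1) hdisj
    exact hdep ⟨g, fun i => hGF i (hg i), hgd⟩
  obtain ⟨S', h1, h2, h3, h4⟩ := hcross.exists_few_pairs S fun i B hB => (hS i B hB).1
  refine ⟨S', F', hF', h2, fun i x hx => (hcover i x hx).imp_left ?_, hsize, h1, h4⟩
  rintro ⟨B, hB, hBx⟩
  obtain ⟨B', hB', hsub⟩ := h3 i B hB
  exact ⟨B', hB', hsub.trans hBx⟩
end
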